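/- Let T be a Y(2|1) T-family in A, let M be a left A-module with highest weight vector Ω, and let ū = (u₁,…,u_a), v̄ = (v₁,…,v_b) be lists whose concatenation is admissible. Then the two explicit expressions for the Bethe vector agree: Σ g(v̄_I,ū_I)·f(ū_I,ū_II)·g(v̄_II,v̄_I)·h(ū_I,ū_I)·λ₂(v̄_I)·𝕋₁₃(ū_I)·T₁₂(ū_II)·𝕋₂₃(v̄_II)·Ω = Σ K_ℓ(v̄_I|ū_I)·f(ū_I,ū_II)·g(v̄_II,v̄_I)·λ₂(ū_I)·𝕋₁₃(v̄_I)·𝕋₂₃(v̄_II)·T₁₂(ū_II)·Ω, where both sums run over all partitions ū = ū_I ⊔ ū_II, v̄ = v̄_I ⊔ v̄_II with #ū_I = #v̄_I = ℓ, λ₂(w̄) = ∏ⱼ λ₂(wⱼ), and h(ū_I,ū_I) = ∏_{u ≠ u′ ∈ ū_I} h(u,u′). -/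

import Mathlib

open scoped BigOperators
open MulOpposite

noncomputable section

namespace Bethe

variable {A : Type*} [Ring A] [Algebra ℂ A]

/-- `g(u,v) = c/(u-v)` -/
def gg (c u v : ℂ) : ℂ := c / (u - v)

/-- `f(u,v) = (u-v+c)/(u-v)` -/
def ff (c u v : ℂ) : ℂ := (u - v + c) / (u - v)

/-- `h(u,v) = (u-v+c)/c` -/
def hh (c u v : ℂ) : ℂ := (u - v + c) / c

/-- A list of parameters is admissible if its entries are pairwise distinct and
`x - y + c ≠ 0` for any two distinct entries `x`, `y`. -/
def Admissible (c : ℂ) (l : List ℂ) : Prop :=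
  l.Pairwise fun x y => x ≠ y ∧ x - y + c ≠ 0 ∧ y - x + c ≠ 0

/-- `∏_{x ∈ xs} ∏_{y ∈ ys} f(x,y)` -/
def prodFF (c : ℂ) (xs ys : List ℂ) : ℂ :=
  (xs.map fun x => (ys.map fun y => ff c x y).prod).prod

/-- `∏_{x ∈ xs} ∏_{y ∈ ys} g(x,y)` -/
def prodGG (c : ℂ) (xs ys : List ℂ) : ℂ :=
  (xs.map fun x => (ys.map fun y => gg c x y).prod).prod

/-- `∏_{x ∈ xs} ∏_{y ∈ ys} h(x,y)` -/
def prodHH (c : ℂ) (xs ys : List ℂ) : ℂ :=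
  (xs.map fun x => (ys.map fun y => hh c x y).prod).prod

/-- `H(w̄) = ∏_{j>k} h(wⱼ,wₖ)` -/
def Hnorm (c : ℂ) : List ℂ → ℂ
  | [] => 1
  | x :: xs => ((xs.map fun y => hh c y x).prod) * Hnorm c xs

/-- `H(w̄*) = ∏_{j<k} h(wⱼ,wₖ)` -/
def HnormRev (c : ℂ) : List ℂ → ℂ
  | [] => 1
  | x :: xs => ((xs.map fun y => hh c x y).prod) * HnormRev c xs

/-- product of `h` over ordered pairs of distinct positions of a list -/
def prodHHne (c : ℂ) (xs : List ℂ) : ℂ :=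
  ∏ j : Fin xs.length, ∏ k : Fin xs.length,
    if j ≠ k then hh c (xs.get j) (xs.get k) else 1

/-- ordered product `T(w₁)⋯T(wₙ)` -/
def Tprod (Tij : ℂ → A) (l : List ℂ) : A := (l.map Tij).prod

/-- normalized ordered product `H(w̄)⁻¹ T(w₁)⋯T(wₙ)` -/
def TT (c : ℂ) (Tij : ℂ → A) (l : List ℂ) : A := (Hnorm c l)⁻¹ • Tprod Tij l

/-- normalized ordered product `H(w̄*)⁻¹ T(w₁)⋯T(wₙ)` -/
def TTrev (c : ℂ) (Tij : ℂ → A) (l : List ℂ) : A := (HnormRev c l)⁻¹ • Tprod Tij l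

/-- The defining (RTT) commutation relations of a super-Yangian `T`-family with
`ℤ₂`-grading `p`. -/
def IsTFam (c : ℂ) {N : ℕ} (p : Fin N → ℕ) (T : Fin N → Fin N → ℂ → A) : Prop :=
  ∀ i j k l : Fin N, ∀ z w : ℂ, z ≠ w →
    T i j z * T k l w - ((-1 : ℂ) ^ ((p i + p j) * (p k + p l))) • (T k l w * T i j z)
      = ((-1 : ℂ) ^ (p l * (p i + p j) + p i * p j) * gg c z w) •
          (T i l z * T k j w - T i l w * T k j z)

/-- the distinguished grading of `gl(2|1)`: `[1]=[2]=0`, `[3]=1` -/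
def p21 : Fin 3 → ℕ := ![0, 0, 1]

/-- the distinguished grading of `gl(1|2)`: `[1]=0`, `[2]=[3]=1` -/
def p12 : Fin 3 → ℕ := ![0, 1, 1]

/-- the sublist of `l` given by the positions in `S`, in the inherited order -/
def sel (l : List ℂ) (S : Finset (Fin l.length)) : List ℂ :=
  (S.sort (· ≤ ·)).map l.get

/-- `λ(w̄) = ∏ⱼ λ(wⱼ)` -/
def lamP (lam2 : ℂ → ℂ) (l : List ℂ) : ℂ := (l.map lam2).prod

/-- The Izergin kernel `K_ℓ(v̄|ū)`. -/
def Kiz (c : ℂ) {ℓ : ℕ} (vs us : Fin ℓ → ℂ) : ℂ :=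
  (∏ j : Fin ℓ, ∏ k : Fin ℓ, if (k : ℕ) < (j : ℕ) then gg c (vs j) (vs k) else 1) *
    (∏ j : Fin ℓ, ∏ k : Fin ℓ, if (k : ℕ) < (j : ℕ) then gg c (us k) (us j) else 1) *
    (∏ j : Fin ℓ, ∏ k : Fin ℓ, hh c (vs j) (us k)) *
    Matrix.det (Matrix.of fun j k => gg c (vs j) (us k) / hh c (vs j) (us k))

/-- The Izergin kernel for lists of equal length (and junk value `0` otherwise). -/
def KizL (c : ℂ) (vs us : List ℂ) : ℂ :=
  if h : vs.length = us.length then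
    Kiz c vs.get fun j => us.get (Fin.cast h j)
  else 0

/-- The operator `X_{a,b}(ū,v̄)` of the paper (`Y(2|1)` case). -/
def X (c : ℂ) (T : Fin 3 → Fin 3 → ℂ → A) (u v : List ℂ) : A :=
  ∑ S : Finset (Fin u.length), ∑ Q : Finset (Fin v.length),
    if S.card = Q.card then
      (prodGG c (sel v Q) (sel u S) * prodFF c (sel u S) (sel u Sᶜ) *
          prodGG c (sel v Qᶜ) (sel v Q) * prodHHne c (sel u S)) •
        (TT c (T 0 2) (sel u S) * Tprod (T 0 1) (sel u Sᶜ) *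
          TT c (T 1 2) (sel v Qᶜ) * Tprod (T 1 1) (sel v Q))
    else 0

/-- The operator `Y_{a,b}(ū,v̄)` of the paper (`Y(2|1)` case). -/
def Y (c : ℂ) (T : Fin 3 → Fin 3 → ℂ → A) (u v : List ℂ) : A :=
  ∑ S : Finset (Fin u.length), ∑ Q : Finset (Fin v.length),
    if S.card = Q.card then
      (KizL c (sel v Q) (sel u S) * prodFF c (sel u S) (sel u Sᶜ) *
          prodGG c (sel v Qᶜ) (sel v Q)) •
        (TT c (T 0 2) (sel v Q) * TT c (T 1 2) (sel v Qᶜ) *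
          Tprod (T 0 1) (sel u Sᶜ) * Tprod (T 1 1) (sel u S))
    else 0

/-- First explicit expression for the `Y(2|1)` Bethe vector (operator part,
the weights `λ₂` included as scalars). -/
def PhiA (c : ℂ) (T : Fin 3 → Fin 3 → ℂ → A) (lam2 : ℂ → ℂ) (u v : List ℂ) : A :=
  ∑ S : Finset (Fin u.length), ∑ Q : Finset (Fin v.length),
    if S.card = Q.card then
      (prodGG c (sel v Q) (sel u S) * prodFF c (sel u S) (sel u Sᶜ) *
          prodGG c (sel v Qᶜ) (sel v Q) * prodHHne c (sel u S) * lamP lam2 (sel v Q)) •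
        (TT c (T 0 2) (sel u S) * Tprod (T 0 1) (sel u Sᶜ) * TT c (T 1 2) (sel v Qᶜ))
    else 0

/-- Second explicit expression for the `Y(2|1)` Bethe vector (operator part). -/
def PhiB (c : ℂ) (T : Fin 3 → Fin 3 → ℂ → A) (lam2 : ℂ → ℂ) (u v : List ℂ) : A :=
  ∑ S : Finset (Fin u.length), ∑ Q : Finset (Fin v.length),
    if S.card = Q.card then
      (KizL c (sel v Q) (sel u S) * prodFF c (sel u S) (sel u Sᶜ) *
          prodGG c (sel v Qᶜ) (sel v Q) * lamP lam2 (sel u S)) •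
        (TT c (T 0 2) (sel v Q) * TT c (T 1 2) (sel v Qᶜ) * Tprod (T 0 1) (sel u Sᶜ))
    else 0

/-- First explicit expression for the `Y(1|2)` Bethe vector, without the overall
sign `(-1)^b` (operator part). -/
def PhiTA (c : ℂ) (T : Fin 3 → Fin 3 → ℂ → A) (lam2 : ℂ → ℂ) (u v : List ℂ) : A :=
  ∑ S : Finset (Fin u.length), ∑ Q : Finset (Fin v.length),
    if S.card = Q.card then
      (prodGG c (sel u S) (sel v Q) * prodFF c (sel v Q) (sel v Qᶜ) *
          prodGG c (sel u Sᶜ) (sel u S) * prodHHne c (sel v Q) * lamP lam2 (sel u S)) •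
        (TT c (T 0 2) (sel v Q) * Tprod (T 1 2) (sel v Qᶜ) * TT c (T 0 1) (sel u Sᶜ))
    else 0

/-- Second explicit expression for the `Y(1|2)` Bethe vector, without the overall
sign `(-1)^b` (operator part). -/
def PhiTB (c : ℂ) (T : Fin 3 → Fin 3 → ℂ → A) (lam2 : ℂ → ℂ) (u v : List ℂ) : A :=
  ∑ S : Finset (Fin u.length), ∑ Q : Finset (Fin v.length),
    if S.card = Q.card then
      (KizL c (sel u S) (sel v Q) * prodFF c (sel v Q) (sel v Qᶜ) *
          prodGG c (sel u Sᶜ) (sel u S) * lamP lam2 (sel v Q)) •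
        (TT c (T 0 2) (sel u S) * TT c (T 0 1) (sel u Sᶜ) * Tprod (T 1 2) (sel v Qᶜ))
    else 0

/-- First explicit expression for the dual `Y(2|1)` Bethe vector, without the
overall sign `(-1)^{b(b-1)/2}`.  `E` is a right `A`-module, i.e. a left
`Aᵐᵒᵖ`-module; `op X • Ωd` is `Ωd · X`. -/
def PsiA {E : Type*} [AddCommGroup E] [Module ℂ E] [Module Aᵐᵒᵖ E]
    (c : ℂ) (T : Fin 3 → Fin 3 → ℂ → A) (lam2 : ℂ → ℂ) (u v : List ℂ) (Ωd : E) : E :=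
  ∑ S : Finset (Fin u.length), ∑ Q : Finset (Fin v.length),
    if S.card = Q.card then
      (prodGG c (sel v Q) (sel u S) * prodFF c (sel u S) (sel u Sᶜ) *
          prodGG c (sel v Qᶜ) (sel v Q) * prodHHne c (sel u S) * lamP lam2 (sel v Q)) •
        (op (TTrev c (T 2 1) (sel v Qᶜ) * Tprod (T 1 0) (sel u Sᶜ) *
              TTrev c (T 2 0) (sel u S)) • Ωd)
    else 0

/-- The dual `Y(2|1)` Bethe vector `Ψ_{a,b}(ū,v̄)`. -/
def Psi {E : Type*} [AddCommGroup E] [Module ℂ E] [Module Aᵐᵒᵖ E]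
    (c : ℂ) (T : Fin 3 → Fin 3 → ℂ → A) (lam2 : ℂ → ℂ) (u v : List ℂ) (Ωd : E) : E :=
  ((-1 : ℂ) ^ (v.length * (v.length - 1) / 2)) • PsiA c T lam2 u v Ωd

/-- Second explicit expression for the dual `Y(2|1)` Bethe vector, without the
overall sign `(-1)^{b(b-1)/2}`. -/
def PsiB {E : Type*} [AddCommGroup E] [Module ℂ E] [Module Aᵐᵒᵖ E]
    (c : ℂ) (T : Fin 3 → Fin 3 → ℂ → A) (lam2 : ℂ → ℂ) (u v : List ℂ) (Ωd : E) : E :=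
  ∑ S : Finset (Fin u.length), ∑ Q : Finset (Fin v.length),
    if S.card = Q.card then
      (KizL c (sel v Q) (sel u S) * prodFF c (sel u S) (sel u Sᶜ) *
          prodGG c (sel v Qᶜ) (sel v Q) * lamP lam2 (sel u S)) •
        (op (Tprod (T 1 0) (sel u Sᶜ) * TTrev c (T 2 1) (sel v Qᶜ) *
              TTrev c (T 2 0) (sel v Q)) • Ωd)
    else 0

section Scalars
open Polynomial

lemma gg_symm (c x y : ℂ) : gg c x y = - gg c y x := by
  unfold gg
  rw [← neg_sub y x, div_neg]

lemma ff_eq (c x y : ℂ) (hc : c ≠ 0) : ff c x y = hh c x y * gg c x y := by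
  unfold ff hh gg
  rw [div_mul_div_cancel₀ hc]

lemma ff_eq' (c x y : ℂ) (h : x ≠ y) : ff c x y = 1 + gg c x y := by
  have := sub_ne_zero.mpr h
  unfold ff gg
  field_simp

lemma hh_self (c x : ℂ) (hc : c ≠ 0) : hh c x x = 1 := by
  unfold hh; simp [hc]

lemma prod_gg_symm (c y : ℂ) (S : Finset ℂ) :
    ∏ x ∈ S, gg c y x = (-1) ^ S.card * ∏ x ∈ S, gg c x y := by
  rw [← Finset.prod_const, ← Finset.prod_mul_distrib]
  refine Finset.prod_congr rfl fun x _ => ?_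
  rw [gg_symm]; ring

/-- Lagrange-type identity -/
lemma pf (c : ℂ) (N : Finset ℂ) (P : ℂ[X]) (hP : P.natDegree + 1 < N.card) :
    ∑ x ∈ N, P.eval x * ∏ y ∈ N.erase x, gg c x y = 0 := by
  have h1 : P.degree < N.card := by
    refine lt_of_le_of_lt Polynomial.degree_le_natDegree ?_
    exact_mod_cast (by omega : P.natDegree < N.card)
  have h2 := Lagrange.coeff_eq_sum (s := N) (v := fun x : ℂ => x)
    (fun _ _ _ _ h => h) h1
  rw [Polynomial.coeff_eq_zero_of_natDegree_lt (by omega)] at h2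
  have h3 : ∀ x ∈ N, P.eval x * ∏ y ∈ N.erase x, gg c x y
      = c ^ (N.card - 1) * (P.eval x / ∏ y ∈ N.erase x, (x - y)) := by
    intro x hx
    unfold gg
    rw [Finset.prod_div_distrib, Finset.prod_const, Finset.card_erase_of_mem hx]
    ring
  rw [Finset.sum_congr rfl h3, ← Finset.mul_sum, ← h2, mul_zero]

/-- the polynomial `∏ h(x,s)` in `x` -/
def hL (c : ℂ) (S : Finset ℂ) : ℂ[X] := ∏ s ∈ S, (C (1 / c) * (Polynomial.X + C (c - s)))
/-- the polynomial `∏ h(s,x)` in `x` -/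
def hR (c : ℂ) (S : Finset ℂ) : ℂ[X] := ∏ s ∈ S, (C (1 / c) * (C (s + c) - Polynomial.X))

lemma eval_hL (c x : ℂ) (S : Finset ℂ) : (hL c S).eval x = ∏ s ∈ S, hh c x s := by
  unfold hL hh
  rw [Polynomial.eval_prod]
  refine Finset.prod_congr rfl fun s _ => ?_
  simp; ring

lemma eval_hR (c x : ℂ) (S : Finset ℂ) : (hR c S).eval x = ∏ s ∈ S, hh c s x := by
  unfold hR hh
  rw [Polynomial.eval_prod]
  refine Finset.prod_congr rfl fun s _ => ?_
  simp; ring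

lemma deg_hL (c : ℂ) (S : Finset ℂ) : (hL c S).natDegree ≤ S.card := by
  unfold hL
  refine (Polynomial.natDegree_prod_le _ _).trans ?_
  rw [Finset.card_eq_sum_ones]
  refine Finset.sum_le_sum fun s _ => ?_
  compute_degree

lemma deg_hR (c : ℂ) (S : Finset ℂ) : (hR c S).natDegree ≤ S.card := by
  unfold hR
  refine (Polynomial.natDegree_prod_le _ _).trans ?_
  rw [Finset.card_eq_sum_ones]
  refine Finset.sum_le_sum fun s _ => ?_
  compute_degree

lemma prod_hh_erase_right (c x : ℂ) (hc : c ≠ 0) (S : Finset ℂ) :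
    ∏ s ∈ S.erase x, hh c x s = ∏ s ∈ S, hh c x s := by
  by_cases h : x ∈ S
  · rw [← Finset.mul_prod_erase S _ h, hh_self c x hc, one_mul]
  · rw [Finset.erase_eq_of_notMem h]

lemma prod_hh_erase_left (c x : ℂ) (hc : c ≠ 0) (S : Finset ℂ) :
    ∏ s ∈ S.erase x, hh c s x = ∏ s ∈ S, hh c s x := by
  by_cases h : x ∈ S
  · rw [← Finset.mul_prod_erase S _ h, hh_self c x hc, one_mul]
  · rw [Finset.erase_eq_of_notMem h]

lemma prod_ff (c x : ℂ) (hc : c ≠ 0) (S : Finset ℂ) :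
    ∏ s ∈ S, ff c x s = (∏ s ∈ S, hh c x s) * ∏ s ∈ S, gg c x s := by
  rw [← Finset.prod_mul_distrib]
  exact Finset.prod_congr rfl fun s _ => ff_eq c x s hc

lemma prod_ff' (c x : ℂ) (hc : c ≠ 0) (S : Finset ℂ) :
    ∏ s ∈ S, ff c s x = (∏ s ∈ S, hh c s x) * ∏ s ∈ S, gg c s x := by
  rw [← Finset.prod_mul_distrib]
  exact Finset.prod_congr rfl fun s _ => ff_eq c s x hc

lemma prod_erase_insert (φ : ℂ → ℂ) {z x : ℂ} {S : Finset ℂ} (hz : z ∉ S) (hx : x ∈ S) :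
    ∏ y ∈ (insert z S).erase x, φ y = φ z * ∏ y ∈ S.erase x, φ y := by
  have hzx : z ≠ x := fun h => hz (h ▸ hx)
  rw [Finset.erase_insert_of_ne hzx, Finset.prod_insert (by simp [hz])]

lemma neg_one_pow_sq (n : ℕ) : ((-1 : ℂ) ^ n) * (-1) ^ n = 1 := by
  rw [← mul_pow]; simp

lemma prod_gg_symm_erase (c y : ℂ) (S : Finset ℂ) (hy : y ∈ S) :
    ∏ x ∈ S.erase y, gg c y x = - (-1) ^ S.card * ∏ x ∈ S.erase y, gg c x y := by
  rw [prod_gg_symm]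
  congr 1
  rw [← Finset.card_erase_add_one hy, pow_succ]; ring

/-- PFa -/
lemma pfa (c : ℂ) (hc : c ≠ 0) (V : Finset ℂ) (y z : ℂ) (hyz : y ≠ z) (hy : y ∉ V)
    (hz : z ∉ V) :
    gg c y z * ∏ x ∈ V, ff c x y + gg c z y * ∏ x ∈ V, ff c x z
      = ∑ j ∈ V, gg c j y * gg c j z * ∏ x ∈ V.erase j, ff c x j := by
  have hy' : y ∉ insert z V := by simp [hyz, hy]
  have key := pf c (insert y (insert z V)) (hR c V) (by
    rw [Finset.card_insert_of_notMem hy', Finset.card_insert_of_notMem hz]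
    have := deg_hR c V
    omega)
  have e := neg_one_pow_sq V.card
  rw [Finset.sum_insert hy', Finset.sum_insert hz, Finset.erase_insert hy',
    prod_erase_insert _ hy' (Finset.mem_insert_self _ _), Finset.erase_insert hz,
    Finset.prod_insert hz, eval_hR, eval_hR, prod_gg_symm c y V, prod_gg_symm c z V] at key
  have h3 : ∀ j ∈ V, (hR c V).eval j * ∏ x ∈ (insert y (insert z V)).erase j, gg c j x
      = - (-1) ^ V.card * (gg c j y * gg c j z * ∏ x ∈ V.erase j, ff c x j) := by
    intro j hj
    rw [prod_erase_insert _ hy' (Finset.mem_insert_of_mem hj), prod_erase_insert _ hz hj,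
      prod_gg_symm_erase _ _ _ hj, eval_hR, prod_ff' c j hc, prod_hh_erase_left c j hc]
    ring
  rw [Finset.sum_congr rfl h3, ← Finset.mul_sum] at key
  rw [prod_ff' c y hc, prod_ff' c z hc]
  linear_combination (-1 : ℂ) ^ V.card * key + (∑ j ∈ V, gg c j y * gg c j z * ∏ x ∈ V.erase j, ff c x j
    - gg c y z * ((∏ s ∈ V, hh c s y) * ∏ s ∈ V, gg c s y)
    - gg c z y * ((∏ s ∈ V, hh c s z) * ∏ s ∈ V, gg c s z)) * e

/-- PF2 -/
lemma pfb (c : ℂ) (hc : c ≠ 0) (Q W S : Finset ℂ) (z : ℂ) (hzQ : z ∉ Q) (hzW : z ∉ W)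
    (hQW : Disjoint Q W) (hcard : S.card < Q.card) :
    (∏ x ∈ Q, gg c x z) * (∏ x ∈ W, ff c z x) * (∏ x ∈ S, hh c z x)
      = ∑ i ∈ W, gg c z i * (∏ x ∈ Q, gg c x i) * (∏ x ∈ W.erase i, ff c i x) *
          (∏ x ∈ S, hh c i x)
        + ∑ j ∈ Q, gg c j z * (∏ x ∈ Q.erase j, gg c x j) * (∏ x ∈ W, ff c j x) *
          (∏ x ∈ S, hh c j x) := by
  have hz : z ∉ Q ∪ W := by simp [hzQ, hzW]
  have key := pf c (insert z (Q ∪ W)) (hL c W * hL c S) (by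
    rw [Finset.card_insert_of_notMem hz, Finset.card_union_of_disjoint hQW]
    have := deg_hL c W
    have := deg_hL c S
    have := Polynomial.natDegree_mul_le (p := hL c W) (q := hL c S)
    omega)
  have e := neg_one_pow_sq Q.card
  rw [Finset.sum_insert hz, Finset.erase_insert hz, Finset.sum_union hQW,
    Finset.prod_union hQW, prod_gg_symm c z Q, Polynomial.eval_mul, eval_hL, eval_hL] at key
  have h3 : ∀ j ∈ Q, (hL c W * hL c S).eval j * ∏ x ∈ (insert z (Q ∪ W)).erase j, gg c j x
      = - (-1) ^ Q.card * (gg c j z * (∏ x ∈ Q.erase j, gg c x j) * (∏ x ∈ W, ff c j x) *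
          (∏ x ∈ S, hh c j x)) := by
    intro j hj
    have hjW : j ∉ W := Finset.disjoint_left.mp hQW hj
    have : (Q ∪ W).erase j = Q.erase j ∪ W := by
      rw [Finset.erase_union_distrib, Finset.erase_eq_of_notMem hjW]
    rw [prod_erase_insert _ hz (Finset.mem_union_left _ hj), this,
      Finset.prod_union (hQW.mono_left (Finset.erase_subset _ _)),
      prod_gg_symm_erase _ _ _ hj, Polynomial.eval_mul, eval_hL, eval_hL, prod_ff c j hc]
    ring
  have h4 : ∀ j ∈ W, (hL c W * hL c S).eval j * ∏ x ∈ (insert z (Q ∪ W)).erase j, gg c j x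
      = - (-1) ^ Q.card * (gg c z j * (∏ x ∈ Q, gg c x j) * (∏ x ∈ W.erase j, ff c j x) *
          (∏ x ∈ S, hh c j x)) := by
    intro j hj
    have hjQ : j ∉ Q := Finset.disjoint_right.mp hQW hj
    have : (Q ∪ W).erase j = Q ∪ W.erase j := by
      rw [Finset.erase_union_distrib, Finset.erase_eq_of_notMem hjQ]
    rw [prod_erase_insert _ hz (Finset.mem_union_right _ hj), this,
      Finset.prod_union (hQW.mono_right (Finset.erase_subset _ _)),
      prod_gg_symm c j Q, Polynomial.eval_mul, eval_hL, eval_hL, prod_ff c j hc,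
      prod_hh_erase_right c j hc, gg_symm c j z]
    ring
  rw [Finset.sum_congr rfl h3, Finset.sum_congr rfl h4, ← Finset.mul_sum, ← Finset.mul_sum] at key
  rw [prod_ff c z hc]
  linear_combination (-1 : ℂ) ^ Q.card * key +
    (∑ i ∈ W, gg c z i * (∏ x ∈ Q, gg c x i) * (∏ x ∈ W.erase i, ff c i x) *
          (∏ x ∈ S, hh c i x)
        + ∑ j ∈ Q, gg c j z * (∏ x ∈ Q.erase j, gg c x j) * (∏ x ∈ W, ff c j x) *
          (∏ x ∈ S, hh c j x) -
    (∏ x ∈ Q, gg c x z) * ((∏ x ∈ W, hh c z x) * (∏ x ∈ W, gg c z x)) * (∏ x ∈ S, hh c z x)) * e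

/-- PF3 -/
lemma pfc (c : ℂ) (hc : c ≠ 0) (W : Finset ℂ) (v z : ℂ) (hzv : z ≠ v) (hzW : z ∉ W)
    (hvW : v ∉ W) :
    gg c v z * (∏ x ∈ W, ff c z x)
      = ∑ i ∈ W, gg c z i * gg c v i * (∏ x ∈ W.erase i, ff c i x)
        + gg c v z * (∏ x ∈ W, ff c v x) := by
  have := pfb c hc {v} W ∅ z (by simpa using hzv) hzW (by simpa using hvW) (by simp)
  simpa using this

/-- PF4 -/
lemma pfd (c : ℂ) (V U : Finset ℂ) (v z : ℂ) (hzv : z ≠ v) (hzU : z ∉ U)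
    (hvU : v ∉ U) (hcard : V.card = U.card) :
    gg c v z * (∏ x ∈ V, hh c x z) * (∏ x ∈ U, gg c z x)
      = gg c v z * (∏ x ∈ V, hh c x v) * (∏ x ∈ U, gg c v x)
        + ∑ i ∈ U, gg c z i * gg c v i * (∏ x ∈ V, hh c x i) * ∏ x ∈ U.erase i, gg c i x := by
  have hz : z ∉ insert v U := by simp [hzv, hzU]
  have key := pf c (insert z (insert v U)) (hR c V) (by
    rw [Finset.card_insert_of_notMem hz, Finset.card_insert_of_notMem hvU]
    have := deg_hR c V
    omega)
  rw [Finset.sum_insert hz, Finset.sum_insert hvU, Finset.erase_insert hz,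
    prod_erase_insert _ hz (Finset.mem_insert_self _ _), Finset.erase_insert hvU,
    Finset.prod_insert hvU, eval_hR, eval_hR] at key
  have h3 : ∀ j ∈ U, (hR c V).eval j * ∏ x ∈ (insert z (insert v U)).erase j, gg c j x
      = gg c z j * gg c v j * (∏ x ∈ V, hh c x j) * ∏ x ∈ U.erase j, gg c j x := by
    intro j hj
    rw [prod_erase_insert _ hz (Finset.mem_insert_of_mem hj), prod_erase_insert _ hvU hj,
      eval_hR, gg_symm c z j, gg_symm c v j]
    ring
  rw [Finset.sum_congr rfl h3] at key
  rw [gg_symm c z v] at key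
  linear_combination -key

end Scalars

section Ops
set_option linter.unusedSectionVars false

/-- all `h(x,y)` are nonzero on `W` -/
def Good (c : ℂ) (W : Finset ℂ) : Prop := ∀ x ∈ W, ∀ y ∈ W, hh c x y ≠ 0

/-- exchange relation of odd generators -/
def QSym (c : ℂ) (Q : ℂ → A) (W : Finset ℂ) : Prop :=
  ∀ x ∈ W, ∀ y ∈ W, hh c x y • (Q x * Q y) = hh c y x • (Q y * Q x)

/-- commutativity on `W` -/
def QCom (Q : ℂ → A) (W : Finset ℂ) : Prop := ∀ x ∈ W, ∀ y ∈ W, Q x * Q y = Q y * Q x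

lemma Tprod_cons (Q : ℂ → A) (x : ℂ) (l : List ℂ) : Tprod Q (x :: l) = Q x * Tprod Q l := by
  simp [Tprod]

lemma TT_cons (c : ℂ) (Q : ℂ → A) (x : ℂ) (l : List ℂ) :
    TT c Q (x :: l) = ((l.map fun y => hh c y x).prod)⁻¹ • (Q x * TT c Q l) := by
  simp only [TT, Tprod_cons, Hnorm, mul_inv, mul_smul_comm, smul_smul]

lemma TT_perm (c : ℂ) (Q : ℂ → A) (W : Finset ℂ) (hG : Good c W) (hQ : QSym c Q W)
    {l₁ l₂ : List ℂ} (h : l₁.Perm l₂) : (∀ x ∈ l₁, x ∈ W) → TT c Q l₁ = TT c Q l₂ := by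
  induction h with
  | nil => intro _; rfl
  | cons x h ih =>
    intro hW
    rw [TT_cons, TT_cons, ih fun y hy => hW y (by simp [hy]), (h.map _).prod_eq]
  | swap x y l =>
    intro hW
    have hx : x ∈ W := hW x (by simp)
    have hy : y ∈ W := hW y (by simp)
    have e := hQ x hx y hy
    have h1 := hG x hx y hy
    have h2 := hG y hy x hx
    simp only [TT_cons, List.map_cons, List.prod_cons, mul_smul_comm, smul_smul, mul_inv,
      ← mul_assoc]
    have e2 : (hh c x y)⁻¹ • (Q y * Q x) = (hh c y x)⁻¹ • (Q x * Q y) := by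
      rw [inv_smul_eq_iff₀ h1, smul_comm, e, smul_smul, inv_mul_cancel₀ h2, one_smul]
    have e3 : ∀ k : ℂ, ((hh c x y)⁻¹ * k) • (Q y * Q x * TT c Q l)
        = ((hh c y x)⁻¹ * k) • (Q x * Q y * TT c Q l) := by
      intro k
      rw [mul_comm, mul_smul, ← smul_mul_assoc, e2, smul_mul_assoc, smul_smul, mul_comm]
    rw [mul_assoc, e3]
    simp only [mul_assoc]
    congr 1; ring
  | trans h1 h2 ih1 ih2 =>
    intro hW
    rw [ih1 hW, ih2 fun x hx => hW x (h1.mem_iff.mpr hx)]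

lemma Tprod_perm (Q : ℂ → A) (W : Finset ℂ) (hQ : QCom Q W)
    {l₁ l₂ : List ℂ} (h : l₁.Perm l₂) : (∀ x ∈ l₁, x ∈ W) → Tprod Q l₁ = Tprod Q l₂ := by
  induction h with
  | nil => intro _; rfl
  | cons x h ih =>
    intro hW
    rw [Tprod_cons, Tprod_cons, ih fun y hy => hW y (by simp [hy])]
  | swap x y l =>
    intro hW
    have hx : x ∈ W := hW x (by simp)
    have hy : y ∈ W := hW y (by simp)
    simp only [Tprod_cons, ← mul_assoc]
    rw [hQ x hx y hy]
  | trans h1 h2 ih1 ih2 =>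
    intro hW
    rw [ih1 hW, ih2 fun x hx => hW x (h1.mem_iff.mpr hx)]

/-- normalized product over a finset -/
def tF (c : ℂ) (Q : ℂ → A) (S : Finset ℂ) : A := TT c Q S.toList
/-- product over a finset -/
def pF (Q : ℂ → A) (S : Finset ℂ) : A := Tprod Q S.toList

lemma tF_empty (c : ℂ) (Q : ℂ → A) : tF c Q ∅ = 1 := by simp [tF, TT, Tprod, Hnorm]
lemma pF_empty (Q : ℂ → A) : pF Q ∅ = 1 := by simp [pF, Tprod]

lemma tF_insert (c : ℂ) (Q : ℂ → A) (W : Finset ℂ) (hG : Good c W) (hQ : QSym c Q W)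
    {x : ℂ} {S : Finset ℂ} (hx : x ∉ S) (hxW : x ∈ W) (hS : S ⊆ W) :
    Q x * tF c Q S = (∏ y ∈ S, hh c y x) • tF c Q (insert x S) := by
  have h := TT_perm c Q W hG hQ (Finset.toList_insert hx) (by
    intro y hy
    rw [Finset.mem_toList, Finset.mem_insert] at hy
    rcases hy with rfl | hy
    · exact hxW
    · exact hS hy)
  unfold tF
  rw [h, TT_cons, Finset.prod_map_toList, smul_smul, mul_inv_cancel₀, one_smul]
  exact Finset.prod_ne_zero_iff.mpr fun y hy => hG y (hS hy) x hxW

lemma pF_insert (Q : ℂ → A) (W : Finset ℂ) (hQ : QCom Q W)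
    {x : ℂ} {S : Finset ℂ} (hx : x ∉ S) (hxW : x ∈ W) (hS : S ⊆ W) :
    pF Q (insert x S) = Q x * pF Q S := by
  have h := Tprod_perm Q W hQ (Finset.toList_insert hx) (by
    intro y hy
    rw [Finset.mem_toList, Finset.mem_insert] at hy
    rcases hy with rfl | hy
    · exact hxW
    · exact hS hy)
  unfold pF
  rw [h, Tprod_cons]

lemma pF_insert' (Q : ℂ → A) (W : Finset ℂ) (hQ : QCom Q W)
    {x : ℂ} {S : Finset ℂ} (hx : x ∉ S) (hxW : x ∈ W) (hS : S ⊆ W) :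
    pF Q (insert x S) = pF Q S * Q x := by
  have h := Tprod_perm Q W hQ ((Finset.toList_insert hx).trans
    (List.perm_append_comm (l₁ := [x]) (l₂ := S.toList))) (by
    intro y hy
    rw [Finset.mem_toList, Finset.mem_insert] at hy
    rcases hy with rfl | hy
    · exact hxW
    · exact hS hy)
  unfold pF
  rw [h]; simp [Tprod]

lemma smul_cancel {k : ℂ} (hk : k ≠ 0) {a b : A} (h : k • a = k • b) : a = b := by
  have := congrArg (fun t => k⁻¹ • t) h
  simpa [smul_smul, hk] using this

/-- multiple commutation relation of the first kind -/
lemma mc1 (c : ℂ) (hc : c ≠ 0) (P Q : ℂ → A) (W : Finset ℂ) (hG : Good c W) (hQ : QSym c Q W)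
    (hPQ : ∀ x ∈ W, ∀ y ∈ W, x ≠ y →
      P x * Q y = ff c y x • (Q y * P x) + gg c x y • (Q x * P y))
    (S : Finset ℂ) : S ⊆ W → ∀ z ∈ W, z ∉ S →
    P z * tF c Q S = (∏ x ∈ S, ff c x z) • (tF c Q S * P z)
      + ∑ w ∈ S, (gg c z w * ∏ x ∈ S.erase w, gg c x w) •
          (Q z * tF c Q (S.erase w) * P w) := by
  induction S using Finset.induction_on with
  | empty => intro _ z _ _; simp [tF_empty]
  | insert y S hy ih =>
    intro hSW z hz hzS
    have hyW : y ∈ W := hSW (Finset.mem_insert_self _ _)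
    have hS : S ⊆ W := fun x hx => hSW (Finset.mem_insert_of_mem hx)
    have hzy : z ≠ y := fun h => hzS (by simp [h])
    have hzS' : z ∉ S := fun h => hzS (by simp [h])
    have hne : (∏ x ∈ S, hh c x y) ≠ 0 :=
      Finset.prod_ne_zero_iff.mpr fun x hx => hG x (hS hx) y hyW
    have ins := tF_insert c Q W hG hQ hy hyW hS
    refine smul_cancel hne ?_
    have lhs : (∏ x ∈ S, hh c x y) • (P z * tF c Q (insert y S))
        = ff c y z • (Q y * (P z * tF c Q S)) + gg c z y • (Q z * (P y * tF c Q S)) := by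
      rw [← mul_smul_comm, ← ins, ← mul_assoc, hPQ z hz y hyW hzy, add_mul]
      simp only [smul_mul_assoc, mul_assoc]
    rw [lhs, ih hS z hz hzS', ih hS y hyW hy, Finset.sum_insert hy, Finset.prod_insert hy,
      Finset.erase_insert hy]
    have hsum : ∀ w ∈ S,
        (∏ x ∈ S, hh c x y) • ((gg c z w * ∏ x ∈ (insert y S).erase w, gg c x w) •
          (Q z * tF c Q ((insert y S).erase w) * P w))
        = ff c y z • (Q y * ((gg c z w * ∏ x ∈ S.erase w, gg c x w) •
          (Q z * tF c Q (S.erase w) * P w)))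
        + gg c z y • (Q z * ((gg c y w * ∏ x ∈ S.erase w, gg c x w) •
          (Q y * tF c Q (S.erase w) * P w))) := by
      intro w hw
      have hyw : y ≠ w := fun h => hy (h ▸ hw)
      have hzw : z ≠ w := fun h => hzS' (h ▸ hw)
      have hye : y ∉ S.erase w := fun h => hy (Finset.mem_of_mem_erase h)
      have ins' := tF_insert c Q W hG hQ hye hyW ((Finset.erase_subset _ _).trans hS)
      have hzyr : hh c y z • (Q y * Q z) = hh c z y • (Q z * Q y) := hQ y hyW z hz
      have e1 : ff c y z • (Q y * (Q z * tF c Q (S.erase w) * P w))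
          = (gg c y z * hh c z y * ∏ x ∈ S.erase w, hh c x y) •
             (Q z * tF c Q (insert y (S.erase w)) * P w) := by
        rw [ff_eq c y z hc, mul_comm (hh c y z), mul_smul]
        have hz3 : hh c y z • (Q y * (Q z * tF c Q (S.erase w) * P w))
            = hh c z y • (Q z * (Q y * tF c Q (S.erase w)) * P w) := by
          have := congrArg (fun t => t * (tF c Q (S.erase w) * P w)) hzyr
          simpa only [smul_mul_assoc, mul_assoc] using this
        rw [hz3, ins']
        simp only [smul_mul_assoc, mul_smul_comm, smul_smul, mul_assoc]
      have e2 : Q z * (Q y * tF c Q (S.erase w) * P w)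
          = (∏ x ∈ S.erase w, hh c x y) • (Q z * tF c Q (insert y (S.erase w)) * P w) := by
        rw [ins']
        simp only [smul_mul_assoc, mul_smul_comm, mul_assoc]
      rw [mul_smul_comm, smul_comm (ff c y z), e1, mul_smul_comm, e2,
        Finset.erase_insert_of_ne hyw, Finset.prod_insert hye]
      simp only [smul_smul, ← add_smul]
      congr 1
      rw [← Finset.mul_prod_erase S (fun x => hh c x y) hw]
      have key : hh c w y * gg c z w * gg c y w
          = gg c z w * gg c y z * hh c z y + gg c z y * gg c y w := by
        unfold gg hh
        have := sub_ne_zero.mpr hyw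
        have := sub_ne_zero.mpr hzw
        have := sub_ne_zero.mpr hzy
        have := sub_ne_zero.mpr hzy.symm
        field_simp
        ring
      linear_combination (∏ x ∈ S.erase w, hh c x y) * (∏ x ∈ S.erase w, gg c x w) * key
    rw [smul_add, smul_add, Finset.smul_sum, Finset.sum_congr rfl hsum, Finset.sum_add_distrib,
      ← Finset.smul_sum, ← Finset.smul_sum, ← Finset.mul_sum, ← Finset.mul_sum]
    have f1 : (∏ x ∈ S, hh c x y) • ((ff c y z * ∏ x ∈ S, ff c x z) •
        (tF c Q (insert y S) * P z)) = ff c y z • (Q y * ((∏ x ∈ S, ff c x z) •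
        (tF c Q S * P z))) := by
      rw [mul_smul_comm, ← mul_assoc, ins]
      simp only [smul_mul_assoc, smul_smul]
      congr 1; ring
    have f2 : (∏ x ∈ S, hh c x y) • ((gg c z y * ∏ x ∈ S, gg c x y) •
        (Q z * tF c Q S * P y)) = gg c z y • (Q z * ((∏ x ∈ S, ff c x y) •
        (tF c Q S * P y))) := by
      rw [mul_smul_comm, ← mul_assoc, prod_ff' c y hc]
      simp only [smul_smul]
      congr 1; ring
    rw [f1, f2, mul_add, mul_add, smul_add, smul_add]
    abel

/-- multiple commutation relation of the second kind -/
lemma mc2 (c : ℂ) (hc : c ≠ 0) (E B : ℂ → A) (W : Finset ℂ) (hE : QCom E W)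
    (hEB : ∀ x ∈ W, ∀ y ∈ W, x ≠ y →
      E x * B y = ff c x y • (B y * E x) + gg c y x • (B x * E y))
    (S : Finset ℂ) : S ⊆ W → ∀ z ∈ W, z ∉ S →
    pF E S * B z = (∏ x ∈ S, ff c x z) • (B z * pF E S)
      + ∑ i ∈ S, (gg c z i * ∏ x ∈ S.erase i, ff c x i) •
          (B i * (E z * pF E (S.erase i))) := by
  induction S using Finset.induction_on with
  | empty => intro _ z _ _; simp [pF_empty]
  | insert y S hy ih =>
    intro hSW z hz hzS
    have hyW : y ∈ W := hSW (Finset.mem_insert_self _ _)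
    have hS : S ⊆ W := fun x hx => hSW (Finset.mem_insert_of_mem hx)
    have hzy : z ≠ y := fun h => hzS (by simp [h])
    have hzS' : z ∉ S := fun h => hzS (by simp [h])
    rw [pF_insert E W hE hy hyW hS, mul_assoc, ih hS z hz hzS', Finset.sum_insert hy,
      Finset.prod_insert hy, Finset.erase_insert hy]
    have hsum : ∀ i ∈ S, E y * ((gg c z i * ∏ x ∈ S.erase i, ff c x i) •
          (B i * (E z * pF E (S.erase i))))
        = (gg c z i * ∏ x ∈ (insert y S).erase i, ff c x i) •
          (B i * (E z * pF E ((insert y S).erase i)))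
          + (gg c z i * gg c i y * ∏ x ∈ S.erase i, ff c x i) • (B y * (E z * pF E S)) := by
      intro i hi
      have hyi : y ≠ i := fun h => hy (h ▸ hi)
      have hye : y ∉ S.erase i := fun h => hy (Finset.mem_of_mem_erase h)
      have hie : i ∉ S.erase i := Finset.notMem_erase i S
      have hSe : S.erase i ⊆ W := (Finset.erase_subset _ _).trans hS
      have e1 : pF E S = E i * pF E (S.erase i) := by
        conv_lhs => rw [← Finset.insert_erase hi]
        exact pF_insert E W hE hie (hS hi) hSe
      rw [Finset.erase_insert_of_ne hyi, Finset.prod_insert hye, pF_insert E W hE hye hyW hSe,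
        mul_smul_comm, ← mul_assoc (E y) (B i), hEB y hyW i (hS hi) hyi, e1,
        ← mul_assoc (E z) (E y), hE z hz y hyW, ← mul_assoc (E z) (E i), hE z hz i (hS hi)]
      simp only [add_mul, smul_mul_assoc, smul_add, smul_smul, mul_assoc]
      congr 2
      · ring
      · ring
    rw [mul_add, Finset.mul_sum, Finset.sum_congr rfl hsum, Finset.sum_add_distrib,
      ← Finset.sum_smul, mul_smul_comm, ← mul_assoc (E y) (B z), hEB y hyW z hz hzy.symm]
    have key : ∑ i ∈ S, gg c z i * gg c i y * ∏ x ∈ S.erase i, ff c x i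
        = gg c z y * ∏ x ∈ S, ff c x y - gg c z y * ∏ x ∈ S, ff c x z := by
      have := pfa c hc S y z hzy.symm hy hzS'
      have h2 : ∑ i ∈ S, gg c z i * gg c i y * ∏ x ∈ S.erase i, ff c x i
          = - ∑ j ∈ S, gg c j y * gg c j z * ∏ x ∈ S.erase j, ff c x j := by
        rw [← Finset.sum_neg_distrib]
        refine Finset.sum_congr rfl fun i _ => ?_
        rw [gg_symm c z i]; ring
      rw [h2, ← this, gg_symm c y z]; ring
    rw [key]
    simp only [add_mul, smul_mul_assoc, smul_add, smul_smul, mul_assoc]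
    module

end Ops

section Kernel

/-- `∏_{k<j} g(vⱼ,vₖ)` -/
def GV (c : ℂ) {n : ℕ} (vs : Fin n → ℂ) : ℂ :=
  ∏ j : Fin n, ∏ k : Fin n, if (k : ℕ) < (j : ℕ) then gg c (vs j) (vs k) else 1
/-- `∏_{k<j} g(uₖ,uⱼ)` -/
def GU (c : ℂ) {n : ℕ} (us : Fin n → ℂ) : ℂ :=
  ∏ j : Fin n, ∏ k : Fin n, if (k : ℕ) < (j : ℕ) then gg c (us k) (us j) else 1

lemma GV_eq (c : ℂ) {n : ℕ} (vs : Fin n → ℂ) :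
    GV c vs = (∏ k : Fin n, ∏ _l ∈ Finset.Ioi k, c) * (Matrix.vandermonde vs).det⁻¹ := by
  unfold GV
  rw [Finset.prod_comm, Matrix.det_vandermonde, ← div_eq_mul_inv, ← Finset.prod_div_distrib]
  refine Finset.prod_congr rfl fun k _ => ?_
  rw [← Finset.prod_div_distrib, ← Finset.prod_filter]
  refine Finset.prod_congr ?_ fun _ _ => rfl
  ext l; simp

lemma GU_eq (c : ℂ) {n : ℕ} (us : Fin n → ℂ) :
    GU c us = (∏ j : Fin n, ∏ k : Fin n, if (k : ℕ) < (j : ℕ) then (-1 : ℂ) else 1) * GV c us := by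
  unfold GU GV
  rw [← Finset.prod_mul_distrib]
  refine Finset.prod_congr rfl fun j _ => ?_
  rw [← Finset.prod_mul_distrib]
  refine Finset.prod_congr rfl fun k _ => ?_
  split_ifs
  · rw [gg_symm]; ring
  · ring

lemma GV_perm (c : ℂ) {n : ℕ} (vs : Fin n → ℂ) (σ : Equiv.Perm (Fin n)) :
    GV c (vs ∘ σ) = ((Equiv.Perm.sign σ : ℤ) : ℂ) * GV c vs := by
  have h : Matrix.vandermonde (vs ∘ σ) = (Matrix.vandermonde vs).submatrix σ id := by
    ext i j; simp [Matrix.vandermonde_apply]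
  rw [GV_eq, GV_eq, h, Matrix.det_permute]
  rcases Int.units_eq_one_or (Equiv.Perm.sign σ) with h | h <;> simp [h]

lemma Kiz_eq (c : ℂ) {n : ℕ} (vs us : Fin n → ℂ) :
    Kiz c vs us = GV c vs * GU c us * (∏ j : Fin n, ∏ k : Fin n, hh c (vs j) (us k)) *
      Matrix.det (Matrix.of fun j k => gg c (vs j) (us k) / hh c (vs j) (us k)) := rfl

lemma sign_sq {n : ℕ} (σ : Equiv.Perm (Fin n)) :
    ((Equiv.Perm.sign σ : ℤ) : ℂ) * ((Equiv.Perm.sign σ : ℤ) : ℂ) = 1 := by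
  rcases Int.units_eq_one_or (Equiv.Perm.sign σ) with h | h <;> simp [h]

lemma Kiz_perm (c : ℂ) {n : ℕ} (vs us : Fin n → ℂ) (σ τ : Equiv.Perm (Fin n)) :
    Kiz c (vs ∘ σ) (us ∘ τ) = Kiz c vs us := by
  rw [Kiz_eq, Kiz_eq, GU_eq, GU_eq, GV_perm, GV_perm]
  have hp : (∏ j : Fin n, ∏ k : Fin n, hh c ((vs ∘ σ) j) ((us ∘ τ) k))
      = ∏ j : Fin n, ∏ k : Fin n, hh c (vs j) (us k) := by
    refine (Equiv.prod_comp σ (fun j => ∏ k, hh c (vs j) ((us ∘ τ) k))).trans ?_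
    exact Finset.prod_congr rfl fun j _ => Equiv.prod_comp τ (fun k => hh c (vs j) (us k))
  have hd : Matrix.det (Matrix.of fun j k => gg c ((vs ∘ σ) j) ((us ∘ τ) k) /
        hh c ((vs ∘ σ) j) ((us ∘ τ) k))
      = ((Equiv.Perm.sign σ : ℤ) : ℂ) * (((Equiv.Perm.sign τ : ℤ) : ℂ) *
        Matrix.det (Matrix.of fun j k => gg c (vs j) (us k) / hh c (vs j) (us k))) := by
    rw [← Matrix.det_permute', ← Matrix.det_permute]
    rfl
  rw [hp, hd]
  have e1 := sign_sq σ
  have e2 := sign_sq τ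
  generalize ((Equiv.Perm.sign σ : ℤ) : ℂ) = s at *
  generalize ((Equiv.Perm.sign τ : ℤ) : ℂ) = t at *
  generalize Matrix.det (Matrix.of fun j k => gg c (vs j) (us k) / hh c (vs j) (us k)) = d
  calc _ = (s * s) * (t * t) * (GV c vs * ((∏ j : Fin n, ∏ k : Fin n,
        if (k : ℕ) < (j : ℕ) then (-1 : ℂ) else 1) * GV c us) *
        (∏ j : Fin n, ∏ k : Fin n, hh c (vs j) (us k)) * d) := by ring
    _ = _ := by rw [e1, e2]; ring

lemma exists_perm {n : ℕ} (f g : Fin n → ℂ) (hf : Function.Injective f)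
    (hg : Function.Injective g) (h : Finset.univ.image f = Finset.univ.image g) :
    ∃ σ : Equiv.Perm (Fin n), g = f ∘ σ := by
  have hr : Set.range f = Set.range g := by
    have := congrArg (fun s : Finset ℂ => (s : Set ℂ)) h
    simpa using this
  refine ⟨(Equiv.ofInjective g hg).trans ((Equiv.setCongr hr.symm).trans
    (Equiv.ofInjective f hf).symm), ?_⟩
  funext i
  exact (Equiv.apply_ofInjective_symm hf
    ((Equiv.setCongr hr.symm) (Equiv.ofInjective g hg i))).symm

/-- The Izergin kernel of finsets -/
def KF (c : ℂ) (V U : Finset ℂ) : ℂ := KizL c V.toList U.toList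

lemma KizL_eq (c : ℂ) {n : ℕ} (l₁ l₂ : List ℂ) (h₁ : l₁.length = n) (h₂ : l₂.length = n) :
    KizL c l₁ l₂ = Kiz c (fun i : Fin n => l₁.get (Fin.cast h₁.symm i))
      (fun i : Fin n => l₂.get (Fin.cast h₂.symm i)) := by
  subst h₁
  unfold KizL
  rw [dif_pos h₂.symm]
  rfl

lemma get_inj {n : ℕ} (l : List ℂ) (h : l.length = n) (hl : l.Nodup) :
    Function.Injective (fun i : Fin n => l.get (Fin.cast h.symm i)) := by
  intro i j hij
  have := List.nodup_iff_injective_get.mp hl hij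
  simpa using this

lemma get_image {n : ℕ} (l : List ℂ) (h : l.length = n) :
    Finset.univ.image (fun i : Fin n => l.get (Fin.cast h.symm i)) = l.toFinset := by
  subst h
  ext x
  simp only [Finset.mem_image, Finset.mem_univ, true_and, List.mem_toFinset]
  exact List.mem_iff_get.symm

lemma KF_image (c : ℂ) {n : ℕ} (vs us : Fin n → ℂ) (hv : Function.Injective vs)
    (hu : Function.Injective us) :
    KF c (Finset.univ.image vs) (Finset.univ.image us) = Kiz c vs us := by
  have h1 : (Finset.univ.image vs).toList.length = n := by
    rw [Finset.length_toList, Finset.card_image_of_injective _ hv]; simp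
  have h2 : (Finset.univ.image us).toList.length = n := by
    rw [Finset.length_toList, Finset.card_image_of_injective _ hu]; simp
  unfold KF
  rw [KizL_eq c _ _ h1 h2]
  obtain ⟨σ, hσ⟩ := exists_perm vs _ hv (get_inj _ h1 (Finset.nodup_toList _))
    (by rw [get_image _ h1]; simp)
  obtain ⟨τ, hτ⟩ := exists_perm us _ hu (get_inj _ h2 (Finset.nodup_toList _))
    (by rw [get_image _ h2]; simp)
  rw [hσ, hτ, Kiz_perm]

lemma KizL_toFinset (c : ℂ) (l₁ l₂ : List ℂ) (h₁ : l₁.Nodup) (h₂ : l₂.Nodup)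
    (h : l₁.length = l₂.length) : KizL c l₁ l₂ = KF c l₁.toFinset l₂.toFinset := by
  rw [KizL_eq c l₁ l₂ h rfl, ← KF_image _ _ _ (get_inj l₁ h h₁) (get_inj l₂ rfl h₂),
    get_image l₁ h, get_image l₂ rfl]

lemma KF_empty (c : ℂ) : KF c ∅ ∅ = 1 := by
  unfold KF
  rw [KizL_eq c (n := 0) _ _ (by simp) (by simp)]
  simp [Kiz]

lemma card_below {n : ℕ} (j : Fin (n + 1)) :
    (∏ k : Fin n, if ((j.succAbove k : Fin (n + 1)) : ℕ) < (j : ℕ) then (-1 : ℂ) else 1)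
      = (-1) ^ (j : ℕ) := by
  rw [← Finset.prod_filter, Finset.prod_const]
  congr 1
  have : (Finset.univ.filter fun k : Fin n => ((j.succAbove k : Fin (n + 1)) : ℕ) < (j : ℕ))
      = Finset.univ.filter fun k : Fin n => (k : ℕ) < j := by
    ext k
    simp only [Finset.mem_filter, Finset.mem_univ, true_and]
    rw [← Fin.lt_def, Fin.succAbove_lt_iff_castSucc_lt, Fin.lt_def]
    simp
  rw [this]
  rw [Fin.card_filter_val_lt]
  omega

lemma GV_succAbove (c : ℂ) {n : ℕ} (vs : Fin (n + 1) → ℂ) (j : Fin (n + 1)) :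
    GV c vs = (-1) ^ (j : ℕ) * (∏ k, gg c (vs (j.succAbove k)) (vs j)) *
      GV c (vs ∘ j.succAbove) := by
  unfold GV
  rw [Fin.prod_univ_succAbove _ j, Fin.prod_univ_succAbove _ j]
  have h : ∀ l : Fin n, (∏ k : Fin (n + 1), if (k : ℕ) < ((j.succAbove l : Fin (n + 1)) : ℕ) then
        gg c (vs (j.succAbove l)) (vs k) else 1)
      = (if (j : ℕ) < ((j.succAbove l : Fin (n + 1)) : ℕ) then
        gg c (vs (j.succAbove l)) (vs j) else 1) *
        ∏ k : Fin n, if (k : ℕ) < (l : ℕ) then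
          gg c ((vs ∘ j.succAbove) l) ((vs ∘ j.succAbove) k) else 1 := by
    intro l
    rw [Fin.prod_univ_succAbove _ j]
    congr 1
    refine Finset.prod_congr rfl fun k _ => ?_
    have : ((j.succAbove k : Fin (n + 1)) : ℕ) < ((j.succAbove l : Fin (n + 1)) : ℕ)
        ↔ (k : ℕ) < l := by
      rw [← Fin.lt_def, ← Fin.lt_def]
      exact (Fin.strictMono_succAbove j).lt_iff_lt
    simp only [this, Function.comp]
  simp only [h, lt_irrefl, if_false, one_mul]
  rw [Finset.prod_mul_distrib, ← mul_assoc]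
  congr 1
  rw [← card_below j, ← Finset.prod_mul_distrib, ← Finset.prod_mul_distrib]
  refine Finset.prod_congr rfl fun k _ => ?_
  have hne : ((j.succAbove k : Fin (n + 1)) : ℕ) ≠ j := by
    intro h; exact Fin.succAbove_ne j k (Fin.ext h)
  rcases lt_or_gt_of_ne hne with h | h
  · rw [if_pos h, if_neg (by omega), if_pos h, gg_symm]; ring
  · rw [if_neg (by omega), if_pos h, if_neg (by omega)]

lemma lap (c : ℂ) {n : ℕ} (vs : Fin (n + 1) → ℂ) (us : Fin n → ℂ) (z : ℂ)
    (hne : ∀ j, hh c (vs j) z ≠ 0) :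
    ∑ j, gg c (vs j) z * (∏ k, hh c (vs (j.succAbove k)) z) * ((∏ k, hh c (vs j) (us k)) *
      (∏ k, gg c (vs (j.succAbove k)) (vs j)) * Kiz c (vs ∘ j.succAbove) us)
    = GV c vs * GU c us * (∏ j, hh c (vs j) z) * (∏ j, ∏ k, hh c (vs j) (us k)) *
      Matrix.det (Matrix.of fun j (k : Fin (n + 1)) =>
        gg c (vs j) ((Fin.cons z us : Fin (n + 1) → ℂ) k) /
          hh c (vs j) ((Fin.cons z us : Fin (n + 1) → ℂ) k)) := by
  rw [Matrix.det_succ_column_zero, Finset.mul_sum]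
  refine Finset.sum_congr rfl fun j _ => ?_
  rw [Kiz_eq, GV_succAbove c vs j, Fin.prod_univ_succAbove (fun j => hh c (vs j) z) j,
    Fin.prod_univ_succAbove (fun j => ∏ k, hh c (vs j) (us k)) j]
  have hs : (Matrix.of fun j (k : Fin (n + 1)) =>
        gg c (vs j) ((Fin.cons z us : Fin (n + 1) → ℂ) k) /
          hh c (vs j) ((Fin.cons z us : Fin (n + 1) → ℂ) k)).submatrix j.succAbove Fin.succ
      = Matrix.of fun i k => gg c ((vs ∘ j.succAbove) i) (us k) /
          hh c ((vs ∘ j.succAbove) i) (us k) := by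
    ext i k; simp
  rw [hs]
  simp only [Matrix.of_apply, Fin.cons_zero, Function.comp]
  have e := neg_one_pow_sq (j : ℕ)
  have h := hne j
  generalize Matrix.det (Matrix.of fun i k => gg c (vs (j.succAbove i)) (us k) /
          hh c (vs (j.succAbove i)) (us k)) = d
  generalize hm : (-1 : ℂ) ^ (j : ℕ) = m at *
  have h2 : gg c (vs j) z = hh c (vs j) z * (gg c (vs j) z / hh c (vs j) z) := by
    field_simp
  generalize gg c (vs j) z / hh c (vs j) z = q at *
  rw [h2]
  calc _ = 1 * (hh c (vs j) z * q * (∏ k, hh c (vs (j.succAbove k)) z) *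
    ((∏ k, hh c (vs j) (us k)) * (∏ k, gg c (vs (j.succAbove k)) (vs j)) *
      (GV c (fun x => vs (j.succAbove x)) * GU c us * (∏ x, ∏ k, hh c (vs (j.succAbove x)) (us k)) * d))) := by
        rw [one_mul]; rfl
    _ = _ := by
        rw [← e]
        have : (vs ∘ j.succAbove) = fun x => vs (j.succAbove x) := rfl
        rw [this]; ring

lemma GU_cons (c : ℂ) {n : ℕ} (us : Fin n → ℂ) (z : ℂ) :
    GU c (Fin.cons z us : Fin (n + 1) → ℂ) = (∏ k, gg c z (us k)) * GU c us := by
  unfold GU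
  rw [Fin.prod_univ_succ, ← Finset.prod_mul_distrib]
  simp [Fin.prod_univ_succ]

lemma exists_enum (V : Finset ℂ) {n : ℕ} (h : V.card = n) :
    ∃ vs : Fin n → ℂ, Function.Injective vs ∧ Finset.univ.image vs = V := by
  have hl : V.toList.length = n := by rw [Finset.length_toList, h]
  exact ⟨_, get_inj _ hl (Finset.nodup_toList _), by rw [get_image _ hl]; simp⟩

lemma image_erase {n : ℕ} (vs : Fin (n + 1) → ℂ) (hv : Function.Injective vs) (j : Fin (n + 1)) :
    (Finset.univ.image vs).erase (vs j) = Finset.univ.image (vs ∘ j.succAbove) := by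
  ext x
  simp only [Finset.mem_erase, Finset.mem_image, Finset.mem_univ, true_and, Function.comp]
  constructor
  · rintro ⟨h, k, rfl⟩
    have : k ≠ j := fun e => h (by rw [e])
    obtain ⟨l, rfl⟩ := Fin.exists_succAbove_eq this
    exact ⟨l, rfl⟩
  · rintro ⟨l, rfl⟩
    exact ⟨fun h => Fin.succAbove_ne j l (hv h), _, rfl⟩

/-- the summand coefficient in the Laplace expansion -/
def CK (c : ℂ) (V U : Finset ℂ) (j : ℂ) : ℂ :=
  (∏ x ∈ U, hh c j x) * (∏ x ∈ V.erase j, gg c x j) * KF c (V.erase j) U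

lemma lapF_aux (c : ℂ) {n : ℕ} (vs : Fin (n + 1) → ℂ) (us : Fin n → ℂ)
    (hv : Function.Injective vs) (hu : Function.Injective us) (z : ℂ) :
    ∑ j ∈ Finset.univ.image vs, gg c j z * (∏ x ∈ (Finset.univ.image vs).erase j, hh c x z) *
        CK c (Finset.univ.image vs) (Finset.univ.image us) j
    = ∑ j, gg c (vs j) z * (∏ k, hh c (vs (j.succAbove k)) z) * ((∏ k, hh c (vs j) (us k)) *
      (∏ k, gg c (vs (j.succAbove k)) (vs j)) * Kiz c (vs ∘ j.succAbove) us) := by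
  rw [Finset.sum_image fun _ _ _ _ h => hv h]
  refine Finset.sum_congr rfl fun j _ => ?_
  have hj : Function.Injective (vs ∘ j.succAbove) := hv.comp Fin.succAbove_right_injective
  unfold CK
  rw [image_erase vs hv j, Finset.prod_image fun _ _ _ _ h => hj h,
    Finset.prod_image fun _ _ _ _ h => hu h, Finset.prod_image fun _ _ _ _ h => hj h,
    KF_image c _ _ hj hu]
  rfl

lemma lapF (c : ℂ) (V U : Finset ℂ) (z : ℂ) (hz : z ∉ U) (hcard : V.card = U.card + 1)
    (hne : ∀ x ∈ V, hh c x z ≠ 0) :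
    KF c V (insert z U) = (∏ x ∈ U, gg c z x) *
      ∑ j ∈ V, gg c j z * (∏ x ∈ V.erase j, hh c x z) * CK c V U j := by
  obtain ⟨n, hn⟩ : ∃ n, U.card = n := ⟨_, rfl⟩
  rw [hn] at hcard
  obtain ⟨vs, hv, rfl⟩ := exists_enum V hcard
  obtain ⟨us, hu, hU⟩ := exists_enum U hn
  have hins : insert z U = Finset.univ.image (Fin.cons z us : Fin (n + 1) → ℂ) := by
    rw [← hU]
    ext x
    simp [Fin.exists_fin_succ, eq_comm]
  have hcons : Function.Injective (Fin.cons z us : Fin (n + 1) → ℂ) := by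
    rw [Fin.cons_injective_iff]
    refine ⟨?_, hu⟩
    rintro ⟨i, hi⟩
    apply hz
    rw [← hU, ← hi]
    simp
  rw [hins, KF_image c _ _ hv hcons, Kiz_eq, GU_cons]
  have h1 := lapF_aux c vs us hv hu z
  rw [hU] at h1
  have h2 : ∏ x ∈ U, gg c z x = ∏ k, gg c z (us k) := by
    rw [← Finset.prod_image (f := fun x => gg c z x) (s := Finset.univ) (g := us)
      fun _ _ _ _ h => hu h, hU]
  rw [h1, lap c vs us z fun j => hne _ (by simp), h2]
  have h3 : (∏ j, ∏ k, hh c (vs j) ((Fin.cons z us : Fin (n + 1) → ℂ) k))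
      = (∏ j, hh c (vs j) z) * ∏ j, ∏ k, hh c (vs j) (us k) := by
    rw [← Finset.prod_mul_distrib]
    refine Finset.prod_congr rfl fun j _ => ?_
    rw [Fin.prod_univ_succ]; simp
  rw [h3]
  ring

lemma lapF_zero (c : ℂ) (V U : Finset ℂ) (z : ℂ) (hz : z ∈ U) (hcard : V.card = U.card + 1)
    (hne : ∀ x ∈ V, hh c x z ≠ 0) :
    ∑ j ∈ V, gg c j z * (∏ x ∈ V.erase j, hh c x z) * CK c V U j = 0 := by
  obtain ⟨n, hn⟩ : ∃ n, U.card = n := ⟨_, rfl⟩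
  rw [hn] at hcard
  obtain ⟨vs, hv, rfl⟩ := exists_enum V hcard
  obtain ⟨us, hu, hU⟩ := exists_enum U hn
  have h1 := lapF_aux c vs us hv hu z
  rw [hU] at h1
  rw [h1, lap c vs us z fun j => hne _ (by simp)]
  have : z ∈ Finset.univ.image us := hU ▸ hz
  obtain ⟨i, -, hi⟩ := Finset.mem_image.mp this
  rw [Matrix.det_zero_of_column_eq (i := 0) (j := i.succ) (Fin.succ_ne_zero i).symm, mul_zero]
  intro k
  simp [hi]

lemma KF_insert (c : ℂ) (hc : c ≠ 0) (V U : Finset ℂ) (z : ℂ) (hz : z ∉ U) (hzV : z ∉ V)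
    (hd : Disjoint V U)
    (hcard : V.card = U.card + 1) (hne : ∀ x ∈ V, ∀ y ∈ insert z U, hh c x y ≠ 0) :
    KF c V (insert z U) = ∑ j ∈ V, gg c j z * (∏ x ∈ U, ff c j x) *
      (∏ x ∈ V.erase j, ff c x j) * KF c (V.erase j) U := by
  rw [lapF c V U z hz hcard fun x hx => hne x hx z (by simp), Finset.mul_sum]
  have h1 : ∀ j ∈ V, (∏ x ∈ U, gg c z x) * (gg c j z * (∏ x ∈ V.erase j, hh c x z) * CK c V U j)
      = gg c j z * (∏ x ∈ U, ff c j x) * (∏ x ∈ V.erase j, ff c x j) * KF c (V.erase j) U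
        + ∑ i ∈ U, gg c z i * (∏ x ∈ U.erase i, gg c i x) *
          (gg c j i * (∏ x ∈ V.erase j, hh c x i) * CK c V U j) := by
    intro j hj
    have hjU : j ∉ U := Finset.disjoint_left.mp hd hj
    have hzj : z ≠ j := fun h => hzV (h ▸ hj)
    have key := pfd c (V.erase j) U j z hzj hz hjU (by
      rw [Finset.card_erase_of_mem hj]; omega)
    have h2 : ∑ i ∈ U, gg c z i * (∏ x ∈ U.erase i, gg c i x) *
          (gg c j i * (∏ x ∈ V.erase j, hh c x i) * CK c V U j)
        = CK c V U j * ∑ i ∈ U, gg c z i * gg c j i * (∏ x ∈ V.erase j, hh c x i) *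
          ∏ x ∈ U.erase i, gg c i x := by
      rw [Finset.mul_sum]
      exact Finset.sum_congr rfl fun i _ => by ring
    rw [h2, prod_ff c j hc, prod_ff' c j hc]
    have h3 : CK c V U j = (∏ x ∈ U, hh c j x) * (∏ x ∈ V.erase j, gg c x j) *
      KF c (V.erase j) U := rfl
    rw [show (∏ x ∈ U, gg c z x) * (gg c j z * (∏ x ∈ V.erase j, hh c x z) * CK c V U j)
      = CK c V U j * (gg c j z * (∏ x ∈ V.erase j, hh c x z) * (∏ x ∈ U, gg c z x)) by ring, key,
      h3]
    ring
  rw [Finset.sum_congr rfl h1, Finset.sum_add_distrib, Finset.sum_comm (s := V) (t := U)]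
  have h4 : ∀ i ∈ U, ∑ j ∈ V, gg c z i * (∏ x ∈ U.erase i, gg c i x) *
          (gg c j i * (∏ x ∈ V.erase j, hh c x i) * CK c V U j) = 0 := by
    intro i hi
    rw [← Finset.mul_sum, lapF_zero c V U i hi hcard fun x hx => hne x hx i (by simp [hi]),
      mul_zero]
  rw [Finset.sum_eq_zero h4, add_zero]

/-- The combination of the residue expansion with a product of `f`s. -/
lemma KF_expand (c : ℂ) (hc : c ≠ 0) (V U W : Finset ℂ) (z : ℂ) (hz : z ∉ U) (hzV : z ∉ V)
    (hzW : z ∉ W) (hd : Disjoint V U) (hVW : Disjoint V W) (hUW : Disjoint U W)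
    (hcard : V.card = U.card + 1) (hne : ∀ x ∈ V, ∀ y ∈ insert z (U ∪ W), hh c x y ≠ 0) :
    KF c V (insert z U) * ∏ x ∈ W, ff c z x
      = ∑ i ∈ W, gg c z i * (∏ x ∈ W.erase i, ff c i x) * KF c V (insert i U)
        + ∑ j ∈ V, gg c j z * (∏ x ∈ W, ff c j x) * (∏ x ∈ U, ff c j x) *
          (∏ x ∈ V.erase j, ff c x j) * KF c (V.erase j) U := by
  rw [KF_insert c hc V U z hz hzV hd hcard fun x hx y hy => hne x hx y (by
    simp only [Finset.mem_insert, Finset.mem_union] at hy ⊢; tauto), Finset.sum_mul]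
  have h1 : ∀ i ∈ W, gg c z i * (∏ x ∈ W.erase i, ff c i x) * KF c V (insert i U)
      = ∑ j ∈ V, gg c z i * gg c j i * (∏ x ∈ W.erase i, ff c i x) *
        ((∏ x ∈ U, ff c j x) * (∏ x ∈ V.erase j, ff c x j) * KF c (V.erase j) U) := by
    intro i hi
    have hiU : i ∉ U := Finset.disjoint_right.mp hUW hi
    have hiV : i ∉ V := Finset.disjoint_right.mp hVW hi
    rw [KF_insert c hc V U i hiU hiV hd hcard fun x hx y hy => hne x hx y (by
      simp only [Finset.mem_insert, Finset.mem_union] at hy ⊢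
      rcases hy with rfl | hy <;> tauto), Finset.mul_sum]
    exact Finset.sum_congr rfl fun j _ => by ring
  rw [Finset.sum_congr rfl h1, Finset.sum_comm, ← Finset.sum_add_distrib]
  refine Finset.sum_congr rfl fun j hj => ?_
  have hjW : j ∉ W := Finset.disjoint_left.mp hVW hj
  have hzj : z ≠ j := fun h => hzV (h ▸ hj)
  rw [← Finset.sum_mul]
  have := pfc c hc W j z hzj hzW hjW
  linear_combination ((∏ x ∈ U, ff c j x) * (∏ x ∈ V.erase j, ff c x j) * KF c (V.erase j) U) * this

end Kernel

section Coefficients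

/-- double product over two finsets -/
def DP (φ : ℂ → ℂ → ℂ) (S Q : Finset ℂ) : ℂ := ∏ x ∈ S, ∏ y ∈ Q, φ x y

lemma DP_insert_left (φ : ℂ → ℂ → ℂ) {S : Finset ℂ} (Q : Finset ℂ) {x : ℂ} (hx : x ∉ S) :
    DP φ (insert x S) Q = (∏ y ∈ Q, φ x y) * DP φ S Q := by
  unfold DP; rw [Finset.prod_insert hx]

lemma DP_insert_right (φ : ℂ → ℂ → ℂ) (S : Finset ℂ) {Q : Finset ℂ} {x : ℂ} (hx : x ∉ Q) :
    DP φ S (insert x Q) = (∏ y ∈ S, φ y x) * DP φ S Q := by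
  unfold DP
  rw [← Finset.prod_mul_distrib]
  exact Finset.prod_congr rfl fun y _ => by rw [Finset.prod_insert hx]

lemma reindex1 {M : Type*} [AddCommMonoid M] (U : Finset ℂ) (F : ℂ → Finset ℂ → M) :
    ∑ S ∈ U.powerset, ∑ i ∈ S, F i S = ∑ S ∈ U.powerset, ∑ i ∈ U \ S, F i (insert i S) := by
  rw [Finset.sum_sigma', Finset.sum_sigma']
  refine Finset.sum_bij' (fun p _ => ⟨p.1.erase p.2, p.2⟩) (fun p _ => ⟨insert p.2 p.1, p.2⟩)
    ?_ ?_ ?_ ?_ ?_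
  · rintro ⟨S, i⟩ h
    simp only [Finset.mem_sigma, Finset.mem_powerset, Finset.mem_sdiff] at h ⊢
    exact ⟨(Finset.erase_subset _ _).trans h.1, h.1 h.2, by simp⟩
  · rintro ⟨S, i⟩ h
    simp only [Finset.mem_sigma, Finset.mem_powerset, Finset.mem_sdiff] at h ⊢
    exact ⟨Finset.insert_subset h.2.1 h.1, by simp⟩
  · rintro ⟨S, i⟩ h
    simp only [Finset.mem_sigma, Finset.mem_powerset] at h
    simp [Finset.insert_erase h.2]
  · rintro ⟨S, i⟩ h
    simp only [Finset.mem_sigma, Finset.mem_powerset, Finset.mem_sdiff] at h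
    simp [Finset.erase_insert h.2.2]
  · rintro ⟨S, i⟩ h
    simp only [Finset.mem_sigma, Finset.mem_powerset] at h
    simp [Finset.insert_erase h.2]

lemma reindex2 {M : Type*} [AddCommMonoid M] (V : Finset ℂ) (F : ℂ → Finset ℂ → M) :
    ∑ j ∈ V, ∑ Q ∈ (V.erase j).powerset, F j Q
      = ∑ Q ∈ V.powerset, ∑ j ∈ Q, F j (Q.erase j) := by
  rw [Finset.sum_sigma', Finset.sum_sigma']
  refine Finset.sum_bij' (fun p _ => ⟨insert p.1 p.2, p.1⟩) (fun p _ => ⟨p.2, p.1.erase p.2⟩)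
    ?_ ?_ ?_ ?_ ?_
  · rintro ⟨j, Q⟩ h
    simp only [Finset.mem_sigma, Finset.mem_powerset] at h ⊢
    exact ⟨Finset.insert_subset h.1 (h.2.trans (Finset.erase_subset _ _)), by simp⟩
  · rintro ⟨Q, j⟩ h
    simp only [Finset.mem_sigma, Finset.mem_powerset] at h ⊢
    exact ⟨h.1 h.2, Finset.erase_subset_erase _ h.1⟩
  · rintro ⟨j, Q⟩ h
    simp only [Finset.mem_sigma, Finset.mem_powerset] at h
    have : j ∉ Q := fun hj => by simpa using h.2 hj
    simp [Finset.erase_insert this]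
  · rintro ⟨Q, j⟩ h
    simp only [Finset.mem_sigma, Finset.mem_powerset] at h
    simp [Finset.insert_erase h.2]
  · rintro ⟨j, Q⟩ h
    simp only [Finset.mem_sigma, Finset.mem_powerset] at h
    have : j ∉ Q := fun hj => by simpa using h.2 hj
    simp [Finset.erase_insert this]

/-- coefficients of the first expression -/
def XC (c : ℂ) (U V S Q : Finset ℂ) : ℂ :=
  if S.card = Q.card then
    DP (gg c) Q S * DP (ff c) S (U \ S) * DP (gg c) (V \ Q) Q * DP (hh c) S S else 0

/-- coefficients of the second expression -/
def YC (c : ℂ) (U V S Q : Finset ℂ) : ℂ :=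
  if S.card = Q.card then
    KF c Q S * DP (ff c) S (U \ S) * DP (gg c) (V \ Q) Q else 0

/-- the coefficient `g(j,z) g(V_j,j) f(j,U)` -/
def cf (c z : ℂ) (U V : Finset ℂ) (j : ℂ) : ℂ :=
  gg c j z * (∏ x ∈ V.erase j, gg c x j) * ∏ x ∈ U, ff c j x

lemma sd1 {U S : Finset ℂ} {z : ℂ} (hz : z ∉ U) (hS : S ⊆ U) :
    (insert z U) \ S = insert z (U \ S) :=
  Finset.insert_sdiff_of_notMem U fun h => hz (hS h)

lemma sd2 {U S : Finset ℂ} {z : ℂ} (hz : z ∉ U) :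
    (insert z U) \ (insert z S) = U \ S := by
  ext x
  simp only [Finset.mem_sdiff, Finset.mem_insert]
  constructor
  · rintro ⟨h1, h2⟩; tauto
  · rintro ⟨h1, h2⟩
    refine ⟨Or.inr h1, ?_⟩
    rintro (rfl | h) <;> tauto

lemma sd3 {U S : Finset ℂ} {i : ℂ} : U \ insert i S = (U \ S).erase i := by
  ext x; simp only [Finset.mem_sdiff, Finset.mem_insert, Finset.mem_erase]; tauto

lemma sd4 {V Q : Finset ℂ} {j : ℂ} (hj : j ∈ Q) : V.erase j \ Q.erase j = V \ Q := by
  ext x; simp only [Finset.mem_sdiff, Finset.mem_erase]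
  constructor
  · rintro ⟨h1, h2⟩; tauto
  · rintro ⟨h1, h2⟩
    exact ⟨⟨fun h => h2 (h ▸ hj), h1⟩, by tauto⟩

lemma DP_erase_right (φ : ℂ → ℂ → ℂ) (S : Finset ℂ) {Q : Finset ℂ} {j : ℂ} (hj : j ∈ Q) :
    DP φ S Q = (∏ y ∈ S, φ y j) * DP φ S (Q.erase j) := by
  conv_lhs => rw [← Finset.insert_erase hj]
  exact DP_insert_right φ S (Finset.notMem_erase _ _)

lemma DP_erase_left (φ : ℂ → ℂ → ℂ) {S : Finset ℂ} (Q : Finset ℂ) {j : ℂ} (hj : j ∈ S) :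
    DP φ S Q = (∏ y ∈ Q, φ j y) * DP φ (S.erase j) Q := by
  conv_lhs => rw [← Finset.insert_erase hj]
  exact DP_insert_left φ Q (Finset.notMem_erase _ _)

lemma prod_split {U S : Finset ℂ} (hS : S ⊆ U) (φ : ℂ → ℂ) :
    ∏ x ∈ U, φ x = (∏ x ∈ S, φ x) * ∏ x ∈ U \ S, φ x := by
  rw [mul_comm, Finset.prod_sdiff hS]

lemma prod_split_erase {V Q : Finset ℂ} {j : ℂ} (hj : j ∈ Q) (hQ : Q ⊆ V) (φ : ℂ → ℂ) :
    ∏ x ∈ V.erase j, φ x = (∏ x ∈ Q.erase j, φ x) * ∏ x ∈ V \ Q, φ x := by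
  rw [prod_split (Finset.erase_subset_erase j hQ) φ, sd4 hj]

lemma XC1 (c : ℂ) {U S : Finset ℂ} (V Q : Finset ℂ) {z : ℂ} (hz : z ∉ U) (hS : S ⊆ U) :
    XC c (insert z U) V S Q = XC c U V S Q * ∏ x ∈ S, ff c x z := by
  unfold XC
  split_ifs
  · rw [sd1 hz hS, DP_insert_right _ _ (by simp [hz])]; ring
  · ring

lemma YC1 (c : ℂ) {U S : Finset ℂ} (V Q : Finset ℂ) {z : ℂ} (hz : z ∉ U) (hS : S ⊆ U) :
    YC c (insert z U) V S Q = YC c U V S Q * ∏ x ∈ S, ff c x z := by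
  unfold YC
  split_ifs
  · rw [sd1 hz hS, DP_insert_right _ _ (by simp [hz])]; ring
  · ring

lemma DP_hh_insert (c : ℂ) (hc : c ≠ 0) {S : Finset ℂ} {z : ℂ} (hz : z ∉ S) :
    DP (hh c) (insert z S) (insert z S)
      = (∏ x ∈ S, hh c z x) * (∏ x ∈ S, hh c x z) * DP (hh c) S S := by
  rw [DP_insert_left _ _ hz, DP_insert_right _ _ hz, Finset.prod_insert hz, hh_self c z hc]
  ring

lemma card_aux {S Q : Finset ℂ} {j : ℂ} (hj : j ∈ Q) :
    S.card = (Q.erase j).card ↔ S.card + 1 = Q.card := by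
  have := Finset.card_erase_add_one hj
  omega

lemma XC2 (c : ℂ) (hc : c ≠ 0) {U S V Q : Finset ℂ} {z : ℂ} (hz : z ∉ U) (hzV : z ∉ V)
    (hd : Disjoint V U) (hS : S ⊆ U) (hQ : Q ⊆ V) :
    XC c (insert z U) V (insert z S) Q = (∏ x ∈ S, hh c x z) *
      (∑ i ∈ U \ S, XC c U V (insert i S) Q * (gg c z i * ∏ x ∈ S, gg c x i)
        + ∑ j ∈ Q, cf c z U V j * XC c U (V.erase j) S (Q.erase j)) := by
  have hzS : z ∉ S := fun h => hz (hS h)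
  by_cases hcard : S.card + 1 = Q.card
  · have key := pfb c hc Q (U \ S) S z (fun h => hzV (hQ h)) (by simp [hz])
      ((hd.mono hQ Finset.sdiff_subset)) (by omega)
    have hi : ∀ i ∈ U \ S, XC c U V (insert i S) Q * (gg c z i * ∏ x ∈ S, gg c x i)
        = (DP (gg c) Q S * DP (ff c) S (U \ S) * DP (gg c) (V \ Q) Q * DP (hh c) S S) *
          (gg c z i * (∏ x ∈ Q, gg c x i) * (∏ x ∈ (U \ S).erase i, ff c i x) *
          (∏ x ∈ S, hh c i x)) := by
      intro i hi
      have hiS : i ∉ S := (Finset.mem_sdiff.mp hi).2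
      unfold XC
      rw [if_pos (by rw [Finset.card_insert_of_notMem hiS, hcard]), sd3,
        DP_insert_right _ _ hiS, DP_insert_left _ _ hiS, DP_hh_insert c hc hiS,
        DP_erase_right _ _ hi, prod_ff' c i hc]
      ring
    have hj : ∀ j ∈ Q, cf c z U V j * XC c U (V.erase j) S (Q.erase j)
        = (DP (gg c) Q S * DP (ff c) S (U \ S) * DP (gg c) (V \ Q) Q * DP (hh c) S S) *
          (gg c j z * (∏ x ∈ Q.erase j, gg c x j) * (∏ x ∈ U \ S, ff c j x) *
          (∏ x ∈ S, hh c j x)) := by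
      intro j hj
      unfold XC cf
      rw [if_pos ((card_aux hj).mpr hcard), sd4 hj, prod_split_erase hj hQ, prod_split hS,
        prod_ff c j hc S, DP_erase_left (gg c) S hj, DP_erase_right (gg c) (V \ Q) hj]
      ring
    rw [Finset.sum_congr rfl hi, Finset.sum_congr rfl hj, ← Finset.mul_sum, ← Finset.mul_sum,
      ← mul_add, ← key]
    unfold XC
    rw [if_pos (by rw [Finset.card_insert_of_notMem hzS, hcard]), sd2 hz,
      DP_insert_right _ _ hzS, DP_insert_left _ _ hzS, DP_hh_insert c hc hzS]
    ring
  · have h1 : XC c (insert z U) V (insert z S) Q = 0 := by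
      unfold XC; rw [if_neg (by rwa [Finset.card_insert_of_notMem hzS])]
    rw [h1, Finset.sum_eq_zero, Finset.sum_eq_zero]
    · ring
    · intro j hj
      unfold XC; rw [if_neg (by rwa [card_aux hj])]; ring
    · intro i hi
      have hiS : i ∉ S := (Finset.mem_sdiff.mp hi).2
      unfold XC; rw [if_neg (by rwa [Finset.card_insert_of_notMem hiS])]; ring

lemma YC2 (c : ℂ) (hc : c ≠ 0) {U S V Q W : Finset ℂ} {z : ℂ} (hG : Good c W)
    (hUW : insert z U ⊆ W) (hVW : V ⊆ W) (hz : z ∉ U) (hzV : z ∉ V)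
    (hd : Disjoint V U) (hS : S ⊆ U) (hQ : Q ⊆ V) :
    YC c (insert z U) V (insert z S) Q =
      (∑ i ∈ U \ S, YC c U V (insert i S) Q * (gg c z i * ∏ x ∈ S, ff c x i)
        + ∑ j ∈ Q, cf c z U V j * YC c U (V.erase j) S (Q.erase j) *
          ∏ x ∈ Q.erase j, hh c x j) := by
  have hzS : z ∉ S := fun h => hz (hS h)
  by_cases hcard : S.card + 1 = Q.card
  · have key := KF_expand c hc Q S (U \ S) z hzS (fun h => hzV (hQ h)) (by simp [hz])
      (hd.mono hQ hS) (hd.mono hQ Finset.sdiff_subset) Finset.disjoint_sdiff hcard.symm (by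
        intro x hx y hy
        refine hG x (hVW (hQ hx)) y (hUW ?_)
        rw [Finset.union_sdiff_of_subset hS] at hy
        exact hy)
    have hi : ∀ i ∈ U \ S, YC c U V (insert i S) Q * (gg c z i * ∏ x ∈ S, ff c x i)
        = (DP (ff c) S (U \ S) * DP (gg c) (V \ Q) Q) *
          (gg c z i * (∏ x ∈ (U \ S).erase i, ff c i x) * KF c Q (insert i S)) := by
      intro i hi
      have hiS : i ∉ S := (Finset.mem_sdiff.mp hi).2
      unfold YC
      rw [if_pos (by rw [Finset.card_insert_of_notMem hiS, hcard]), sd3,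
        DP_insert_left _ _ hiS, DP_erase_right _ _ hi]
      ring
    have hj : ∀ j ∈ Q, cf c z U V j * YC c U (V.erase j) S (Q.erase j) *
          ∏ x ∈ Q.erase j, hh c x j
        = (DP (ff c) S (U \ S) * DP (gg c) (V \ Q) Q) *
          (gg c j z * (∏ x ∈ U \ S, ff c j x) * (∏ x ∈ S, ff c j x) *
          (∏ x ∈ Q.erase j, ff c x j) * KF c (Q.erase j) S) := by
      intro j hj
      unfold YC cf
      rw [if_pos ((card_aux hj).mpr hcard), sd4 hj, prod_split_erase hj hQ, prod_split hS,
        prod_ff' c j hc (Q.erase j), DP_erase_right (gg c) (V \ Q) hj]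
      ring
    rw [Finset.sum_congr rfl hi, Finset.sum_congr rfl hj, ← Finset.mul_sum, ← Finset.mul_sum,
      ← mul_add, ← key]
    unfold YC
    rw [if_pos (by rw [Finset.card_insert_of_notMem hzS, hcard]), sd2 hz,
      DP_insert_left _ _ hzS]
    ring
  · have h1 : YC c (insert z U) V (insert z S) Q = 0 := by
      unfold YC; rw [if_neg (by rwa [Finset.card_insert_of_notMem hzS])]
    rw [h1, Finset.sum_eq_zero, Finset.sum_eq_zero]
    · ring
    · intro j hj
      unfold YC; rw [if_neg (by rwa [card_aux hj])]; ring
    · intro i hi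
      have hiS : i ∉ S := (Finset.mem_sdiff.mp hi).2
      unfold YC; rw [if_neg (by rwa [Finset.card_insert_of_notMem hiS])]; ring

end Coefficients

section Recursion

/-- The exchange relations needed in the proof, for parameters in a finite set `W`. -/
structure Rel (c : ℂ) (B C D E : ℂ → A) (W : Finset ℂ) : Prop where
  good : Good c W
  BB : QCom B W
  EE : QCom E W
  CC : QSym c C W
  DD : QSym c D W
  BC : ∀ x ∈ W, ∀ y ∈ W, x ≠ y →
    B x * C y = ff c y x • (C y * B x) + gg c x y • (C x * B y)
  EB : ∀ x ∈ W, ∀ y ∈ W, x ≠ y →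
    E x * B y = ff c x y • (B y * E x) + gg c y x • (B x * E y)
  ED : ∀ x ∈ W, ∀ y ∈ W, x ≠ y →
    E x * D y = ff c y x • (D y * E x) + gg c x y • (D x * E y)
  DC : ∀ x ∈ W, ∀ y ∈ W, x ≠ y →
    D x * C y = -(ff c y x • (C y * D x)) + gg c y x • (C x * D y)
  BD : ∀ x ∈ W, ∀ y ∈ W, x ≠ y →
    B x * D y - D y * B x = gg c x y • (C x * E y - C y * E x)

/-- the first operator, indexed by finsets -/
def XF (c : ℂ) (B C D E : ℂ → A) (U V : Finset ℂ) : A :=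
  ∑ S ∈ U.powerset, ∑ Q ∈ V.powerset, XC c U V S Q •
    (tF c C S * pF B (U \ S) * (tF c D (V \ Q) * pF E Q))

/-- the second operator, indexed by finsets -/
def YF (c : ℂ) (B C D E : ℂ → A) (U V : Finset ℂ) : A :=
  ∑ S ∈ U.powerset, ∑ Q ∈ V.powerset, YC c U V S Q •
    (tF c C Q * tF c D (V \ Q) * (pF B (U \ S) * pF E S))

variable {c : ℂ} {B C D E : ℂ → A} {W : Finset ℂ}

lemma XF_L (hc : c ≠ 0) (h : Rel c B C D E W) {U V : Finset ℂ} {z : ℂ}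
    (hU : insert z U ⊆ W) (hV : V ⊆ W) (hz : z ∉ U) (hzV : z ∉ V) (hd : Disjoint V U) :
    XF c B C D E (insert z U) V = B z * XF c B C D E U V
      + ∑ j ∈ V, cf c z U V j • (C z * XF c B C D E U (V.erase j) * E j) := by
  have hzW : z ∈ W := hU (Finset.mem_insert_self _ _)
  have hUW : U ⊆ W := fun x hx => hU (Finset.mem_insert_of_mem hx)
  have e1 : XF c B C D E (insert z U) V
      = (∑ S ∈ U.powerset, ∑ Q ∈ V.powerset, (XC c U V S Q * ∏ x ∈ S, ff c x z) •
          (tF c C S * B z * pF B (U \ S) * (tF c D (V \ Q) * pF E Q)))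
        + ∑ S ∈ U.powerset, ∑ Q ∈ V.powerset,
          (∑ i ∈ U \ S, XC c U V (insert i S) Q * (gg c z i * ∏ x ∈ S, gg c x i)
            + ∑ j ∈ Q, cf c z U V j * XC c U (V.erase j) S (Q.erase j)) •
          (C z * tF c C S * pF B (U \ S) * (tF c D (V \ Q) * pF E Q)) := by
    unfold XF
    rw [Finset.sum_powerset_insert hz]
    congr 1
    · refine Finset.sum_congr rfl fun S hS => Finset.sum_congr rfl fun Q _ => ?_
      have hS := Finset.mem_powerset.mp hS
      rw [XC1 c V Q hz hS, sd1 hz hS, pF_insert B W h.BB (by simp [hz]) hzW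
        (Finset.sdiff_subset.trans hUW)]
      simp only [mul_assoc]
    · refine Finset.sum_congr rfl fun S hS => Finset.sum_congr rfl fun Q hQ => ?_
      have hS := Finset.mem_powerset.mp hS
      have hQ := Finset.mem_powerset.mp hQ
      have hzS : z ∉ S := fun h => hz (hS h)
      rw [XC2 c hc hz hzV hd hS hQ, sd2 hz,
        tF_insert c C W h.good h.CC hzS hzW (hS.trans hUW)]
      simp only [smul_mul_assoc, smul_smul]
      rw [mul_comm]
  have e2 : B z * XF c B C D E U V
      = (∑ S ∈ U.powerset, ∑ Q ∈ V.powerset, (XC c U V S Q * ∏ x ∈ S, ff c x z) •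
          (tF c C S * B z * pF B (U \ S) * (tF c D (V \ Q) * pF E Q)))
        + ∑ S ∈ U.powerset, ∑ i ∈ U \ S, ∑ Q ∈ V.powerset,
          (XC c U V (insert i S) Q * (gg c z i * ∏ x ∈ S, gg c x i)) •
          (C z * tF c C S * pF B (U \ S) * (tF c D (V \ Q) * pF E Q)) := by
    have e3 : ∑ S ∈ U.powerset, ∑ i ∈ U \ S, ∑ Q ∈ V.powerset,
          (XC c U V (insert i S) Q * (gg c z i * ∏ x ∈ S, gg c x i)) •
          (C z * tF c C S * pF B (U \ S) * (tF c D (V \ Q) * pF E Q))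
        = ∑ S ∈ U.powerset, ∑ i ∈ S, ∑ Q ∈ V.powerset,
          (XC c U V S Q * (gg c z i * ∏ x ∈ S.erase i, gg c x i)) •
          (C z * tF c C (S.erase i) * B i * pF B (U \ S) * (tF c D (V \ Q) * pF E Q)) := by
      rw [reindex1 U (fun i S => ∑ Q ∈ V.powerset,
          (XC c U V S Q * (gg c z i * ∏ x ∈ S.erase i, gg c x i)) •
          (C z * tF c C (S.erase i) * B i * pF B (U \ S) * (tF c D (V \ Q) * pF E Q)))]
      refine Finset.sum_congr rfl fun S hS => Finset.sum_congr rfl fun i hi =>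
        Finset.sum_congr rfl fun Q _ => ?_
      have hiS : i ∉ S := (Finset.mem_sdiff.mp hi).2
      have hp := pF_insert B W h.BB (x := i) (S := (U \ S).erase i) (Finset.notMem_erase _ _)
        (hUW (Finset.mem_sdiff.mp hi).1)
        ((Finset.erase_subset _ _).trans (Finset.sdiff_subset.trans hUW))
      rw [Finset.insert_erase hi] at hp
      rw [hp, Finset.erase_insert hiS, sd3]
      simp only [mul_assoc]
    rw [e3, ← Finset.sum_add_distrib]
    unfold XF
    rw [Finset.mul_sum]
    refine Finset.sum_congr rfl fun S hS => ?_
    have hS := Finset.mem_powerset.mp hS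
    rw [Finset.sum_comm (s := S), ← Finset.sum_add_distrib, Finset.mul_sum]
    refine Finset.sum_congr rfl fun Q _ => ?_
    have hm := mc1 c hc B C W h.good h.CC h.BC S (hS.trans hUW) z hzW (fun h => hz (hS h))
    rw [mul_smul_comm, ← mul_assoc (B z), ← mul_assoc (B z), hm]
    simp only [add_mul, Finset.sum_mul, smul_add, Finset.smul_sum, smul_mul_assoc, smul_smul]
  have e4 : ∑ j ∈ V, cf c z U V j • (C z * XF c B C D E U (V.erase j) * E j)
      = ∑ S ∈ U.powerset, ∑ Q ∈ V.powerset, ∑ j ∈ Q,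
        (cf c z U V j * XC c U (V.erase j) S (Q.erase j)) •
          (C z * tF c C S * pF B (U \ S) * (tF c D (V \ Q) * pF E Q)) := by
    have e5 : ∀ j ∈ V, cf c z U V j • (C z * XF c B C D E U (V.erase j) * E j)
        = ∑ S ∈ U.powerset, ∑ Q ∈ (V.erase j).powerset,
          (cf c z U V j * XC c U (V.erase j) S Q) •
          (C z * tF c C S * pF B (U \ S) * (tF c D (V.erase j \ Q) * (pF E Q * E j))) := by
      intro j _
      unfold XF
      simp only [Finset.mul_sum, Finset.sum_mul, Finset.smul_sum, mul_smul_comm, smul_mul_assoc,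
        smul_smul, mul_assoc]
    rw [Finset.sum_congr rfl e5, Finset.sum_comm]
    refine Finset.sum_congr rfl fun S hS => ?_
    rw [reindex2 V (fun j Q => (cf c z U V j * XC c U (V.erase j) S Q) •
          (C z * tF c C S * pF B (U \ S) * (tF c D (V.erase j \ Q) * (pF E Q * E j))))]
    refine Finset.sum_congr rfl fun Q hQ => Finset.sum_congr rfl fun j hj => ?_
    have hQ := Finset.mem_powerset.mp hQ
    have hp := pF_insert' E W h.EE (x := j) (S := Q.erase j) (Finset.notMem_erase _ _)
      (hV (hQ hj)) ((Finset.erase_subset _ _).trans (hQ.trans hV))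
    rw [Finset.insert_erase hj] at hp
    rw [hp, sd4 hj]
  rw [e1, e2, e4, add_assoc]
  congr 1
  rw [← Finset.sum_add_distrib]
  refine Finset.sum_congr rfl fun S _ => ?_
  rw [Finset.sum_comm (s := U \ S), ← Finset.sum_add_distrib]
  refine Finset.sum_congr rfl fun Q _ => ?_
  rw [add_smul, Finset.sum_smul, Finset.sum_smul]

lemma YF_R (hc : c ≠ 0) (h : Rel c B C D E W) {U V : Finset ℂ} {z : ℂ}
    (hU : insert z U ⊆ W) (hV : V ⊆ W) (hz : z ∉ U) (hzV : z ∉ V) (hd : Disjoint V U) :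
    YF c B C D E (insert z U) V = YF c B C D E U V * B z
      + ∑ j ∈ V, cf c z U V j • (C j * YF c B C D E U (V.erase j) * E z) := by
  have hzW : z ∈ W := hU (Finset.mem_insert_self _ _)
  have hUW : U ⊆ W := fun x hx => hU (Finset.mem_insert_of_mem hx)
  have e1 : YF c B C D E (insert z U) V
      = (∑ S ∈ U.powerset, ∑ Q ∈ V.powerset, (YC c U V S Q * ∏ x ∈ S, ff c x z) •
          (tF c C Q * tF c D (V \ Q) * (pF B (U \ S) * (B z * pF E S))))
        + ∑ S ∈ U.powerset, ∑ Q ∈ V.powerset,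
          (∑ i ∈ U \ S, YC c U V (insert i S) Q * (gg c z i * ∏ x ∈ S, ff c x i)
            + ∑ j ∈ Q, cf c z U V j * YC c U (V.erase j) S (Q.erase j) *
              ∏ x ∈ Q.erase j, hh c x j) •
          (tF c C Q * tF c D (V \ Q) * (pF B (U \ S) * (E z * pF E S))) := by
    unfold YF
    rw [Finset.sum_powerset_insert hz]
    congr 1
    · refine Finset.sum_congr rfl fun S hS => Finset.sum_congr rfl fun Q _ => ?_
      have hS := Finset.mem_powerset.mp hS
      rw [YC1 c V Q hz hS, sd1 hz hS, pF_insert' B W h.BB (by simp [hz]) hzW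
        (Finset.sdiff_subset.trans hUW)]
      simp only [mul_assoc]
    · refine Finset.sum_congr rfl fun S hS => Finset.sum_congr rfl fun Q hQ => ?_
      have hS := Finset.mem_powerset.mp hS
      have hQ := Finset.mem_powerset.mp hQ
      have hzS : z ∉ S := fun h => hz (hS h)
      rw [YC2 c hc h.good hU hV hz hzV hd hS hQ, sd2 hz,
        pF_insert E W h.EE hzS hzW (hS.trans hUW)]
  have e2 : YF c B C D E U V * B z
      = (∑ S ∈ U.powerset, ∑ Q ∈ V.powerset, (YC c U V S Q * ∏ x ∈ S, ff c x z) •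
          (tF c C Q * tF c D (V \ Q) * (pF B (U \ S) * (B z * pF E S))))
        + ∑ S ∈ U.powerset, ∑ i ∈ U \ S, ∑ Q ∈ V.powerset,
          (YC c U V (insert i S) Q * (gg c z i * ∏ x ∈ S, ff c x i)) •
          (tF c C Q * tF c D (V \ Q) * (pF B (U \ S) * (E z * pF E S))) := by
    have e3 : ∑ S ∈ U.powerset, ∑ i ∈ U \ S, ∑ Q ∈ V.powerset,
          (YC c U V (insert i S) Q * (gg c z i * ∏ x ∈ S, ff c x i)) •
          (tF c C Q * tF c D (V \ Q) * (pF B (U \ S) * (E z * pF E S)))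
        = ∑ S ∈ U.powerset, ∑ i ∈ S, ∑ Q ∈ V.powerset,
          (YC c U V S Q * (gg c z i * ∏ x ∈ S.erase i, ff c x i)) •
          (tF c C Q * tF c D (V \ Q) * (pF B (U \ S) * (B i * (E z * pF E (S.erase i))))) := by
      rw [reindex1 U (fun i S => ∑ Q ∈ V.powerset,
          (YC c U V S Q * (gg c z i * ∏ x ∈ S.erase i, ff c x i)) •
          (tF c C Q * tF c D (V \ Q) * (pF B (U \ S) * (B i * (E z * pF E (S.erase i))))))]
      refine Finset.sum_congr rfl fun S hS => Finset.sum_congr rfl fun i hi =>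
        Finset.sum_congr rfl fun Q _ => ?_
      have hiS : i ∉ S := (Finset.mem_sdiff.mp hi).2
      have hp := pF_insert' B W h.BB (x := i) (S := (U \ S).erase i) (Finset.notMem_erase _ _)
        (hUW (Finset.mem_sdiff.mp hi).1)
        ((Finset.erase_subset _ _).trans (Finset.sdiff_subset.trans hUW))
      rw [Finset.insert_erase hi] at hp
      rw [hp, Finset.erase_insert hiS, sd3]
      simp only [mul_assoc]
    rw [e3, ← Finset.sum_add_distrib]
    unfold YF
    rw [Finset.sum_mul]
    refine Finset.sum_congr rfl fun S hS => ?_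
    have hS := Finset.mem_powerset.mp hS
    rw [Finset.sum_comm (s := S), ← Finset.sum_add_distrib, Finset.sum_mul]
    refine Finset.sum_congr rfl fun Q _ => ?_
    have hm := mc2 c hc E B W h.EE h.EB S (hS.trans hUW) z hzW (fun h => hz (hS h))
    rw [smul_mul_assoc, mul_assoc, mul_assoc (pF B (U \ S)), hm]
    simp only [mul_add, Finset.mul_sum, smul_add, Finset.smul_sum, mul_smul_comm, smul_smul]
  have e4 : ∑ j ∈ V, cf c z U V j • (C j * YF c B C D E U (V.erase j) * E z)
      = ∑ S ∈ U.powerset, ∑ Q ∈ V.powerset, ∑ j ∈ Q,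
        (cf c z U V j * YC c U (V.erase j) S (Q.erase j) * ∏ x ∈ Q.erase j, hh c x j) •
          (tF c C Q * tF c D (V \ Q) * (pF B (U \ S) * (E z * pF E S))) := by
    have e5 : ∀ j ∈ V, cf c z U V j • (C j * YF c B C D E U (V.erase j) * E z)
        = ∑ S ∈ U.powerset, ∑ Q ∈ (V.erase j).powerset,
          (cf c z U V j * YC c U (V.erase j) S Q) •
          (C j * tF c C Q * (tF c D (V.erase j \ Q) * (pF B (U \ S) * (pF E S * E z)))) := by
      intro j _
      unfold YF
      simp only [Finset.mul_sum, Finset.sum_mul, Finset.smul_sum, mul_smul_comm, smul_mul_assoc,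
        smul_smul, mul_assoc]
    rw [Finset.sum_congr rfl e5, Finset.sum_comm]
    refine Finset.sum_congr rfl fun S hS => ?_
    have hS := Finset.mem_powerset.mp hS
    have hzS : z ∉ S := fun h => hz (hS h)
    rw [reindex2 V (fun j Q => (cf c z U V j * YC c U (V.erase j) S Q) •
          (C j * tF c C Q * (tF c D (V.erase j \ Q) * (pF B (U \ S) * (pF E S * E z)))))]
    refine Finset.sum_congr rfl fun Q hQ => Finset.sum_congr rfl fun j hj => ?_
    have hQ := Finset.mem_powerset.mp hQ
    have hp := tF_insert c C W h.good h.CC (x := j) (S := Q.erase j) (Finset.notMem_erase _ _)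
      (hV (hQ hj)) ((Finset.erase_subset _ _).trans (hQ.trans hV))
    rw [Finset.insert_erase hj] at hp
    rw [hp, sd4 hj, ← pF_insert' E W h.EE hzS hzW (hS.trans hUW),
      pF_insert E W h.EE hzS hzW (hS.trans hUW)]
    simp only [smul_mul_assoc, smul_smul, mul_assoc]
  rw [e1, e2, e4, add_assoc]
  congr 1
  rw [← Finset.sum_add_distrib]
  refine Finset.sum_congr rfl fun S _ => ?_
  rw [Finset.sum_comm (s := U \ S), ← Finset.sum_add_distrib]
  refine Finset.sum_congr rfl fun Q _ => ?_
  rw [add_smul, Finset.sum_smul, Finset.sum_smul]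

lemma XF_empty (V : Finset ℂ) : XF c B C D E ∅ V = tF c D V := by
  unfold XF
  rw [Finset.powerset_empty, Finset.sum_singleton, Finset.sum_eq_single ∅]
  · simp [XC, DP, tF_empty, pF_empty]
  · intro Q _ hQ
    unfold XC
    rw [if_neg, zero_smul]
    rw [Finset.card_empty]
    exact fun h => hQ (Finset.card_eq_zero.mp h.symm)
  · intro h; simp at h

lemma YF_empty (V : Finset ℂ) : YF c B C D E ∅ V = tF c D V := by
  unfold YF
  rw [Finset.powerset_empty, Finset.sum_singleton, Finset.sum_eq_single ∅]
  · simp [YC, DP, tF_empty, pF_empty, KF_empty]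
  · intro Q _ hQ
    unfold YC
    rw [if_neg, zero_smul]
    rw [Finset.card_empty]
    exact fun h => hQ (Finset.card_eq_zero.mp h.symm)
  · intro h; simp at h

end Recursion

section Base
variable {c : ℂ} {B C D E : ℂ → A} {W : Finset ℂ}

lemma comm_one (hc : c ≠ 0) (h : Rel c B C D E W) {z : ℂ} (hzW : z ∈ W) (V : Finset ℂ) :
    V ⊆ W → z ∉ V →
    B z * tF c D V - tF c D V * B z = ∑ j ∈ V, (gg c j z * ∏ x ∈ V.erase j, gg c x j) •
      (C j * tF c D (V.erase j) * E z - C z * tF c D (V.erase j) * E j) := by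
  induction V using Finset.induction_on with
  | empty => intro _ _; simp [tF_empty]
  | insert y V hy ih =>
    intro hVW hzV
    have hyW : y ∈ W := hVW (Finset.mem_insert_self _ _)
    have hV : V ⊆ W := fun x hx => hVW (Finset.mem_insert_of_mem hx)
    have hzy : z ≠ y := fun h => hzV (by simp [h])
    have hzV' : z ∉ V := fun h => hzV (by simp [h])
    have ih := ih hV hzV'
    have hη : (∏ x ∈ V, hh c x y) ≠ 0 :=
      Finset.prod_ne_zero_iff.mpr fun x hx => h.good x (hV hx) y hyW
    have hins := tF_insert c D W h.good h.DD hy hyW hV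
    apply smul_cancel hη
    rw [smul_sub, ← mul_smul_comm, ← smul_mul_assoc, ← hins]
    -- left-hand side
    have hBD : B z * D y = D y * B z + gg c z y • (C z * E y - C y * E z) := by
      rw [← h.BD z hzW y hyW hzy]; abel
    have l1 : B z * (D y * tF c D V) - D y * tF c D V * B z
        = gg c z y • (C z * (E y * tF c D V)) - gg c z y • (C y * (E z * tF c D V))
          + D y * (B z * tF c D V - tF c D V * B z) := by
      rw [← mul_assoc, hBD]
      simp only [add_mul, sub_mul, mul_sub, smul_mul_assoc, smul_sub, mul_assoc]
      abel
    have m1 := mc1 c hc E D W h.good h.DD h.ED V hV y hyW hy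
    have m2 := mc1 c hc E D W h.good h.DD h.ED V hV z hzW hzV'
    have l2 : ∀ j ∈ V,
        gg c z y • (C z * ((gg c y j * ∏ x ∈ V.erase j, gg c x j) •
            (D y * tF c D (V.erase j) * E j)))
          - gg c z y • (C y * ((gg c z j * ∏ x ∈ V.erase j, gg c x j) •
            (D z * tF c D (V.erase j) * E j)))
          + D y * ((gg c j z * ∏ x ∈ V.erase j, gg c x j) •
            (C j * tF c D (V.erase j) * E z - C z * tF c D (V.erase j) * E j))
        = (gg c j y * gg c j z * ∏ x ∈ V.erase j, ff c x j) • (C y * tF c D V * E z)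
          + (∏ x ∈ V, hh c x y) • (gg c j z * ∏ x ∈ (insert y V).erase j, gg c x j) •
            (C j * tF c D ((insert y V).erase j) * E z
              - C z * tF c D ((insert y V).erase j) * E j) := by
      intro j hj
      have hjW : j ∈ W := hV hj
      have hjy : j ≠ y := fun h => hy (h ▸ hj)
      have hjz : j ≠ z := fun h => hzV' (h ▸ hj)
      have hyj : y ∉ V.erase j := fun h => hy (Finset.mem_of_mem_erase h)
      have hVj : V.erase j ⊆ W := (Finset.erase_subset _ _).trans hV
      have i1 := tF_insert c D W h.good h.DD hyj hyW hVj
      have i2 := tF_insert c D W h.good h.DD (Finset.notMem_erase j V) hjW hVj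
      rw [Finset.insert_erase hj] at i2
      have i3 : (insert y V).erase j = insert y (V.erase j) :=
        Finset.erase_insert_of_ne hjy.symm
      have d1 : D y * (C j * tF c D (V.erase j) * E z)
          = -(ff c j y • (C j * (D y * tF c D (V.erase j)) * E z))
            + gg c j y • (C y * (D j * tF c D (V.erase j)) * E z) := by
        rw [← mul_assoc, ← mul_assoc, h.DC y hyW j hjW hjy.symm]
        simp only [add_mul, neg_mul, smul_mul_assoc, mul_assoc]
      have d2 : D y * (C z * tF c D (V.erase j) * E j)
          = -(ff c z y • (C z * (D y * tF c D (V.erase j)) * E j))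
            + gg c z y • (C y * (D z * tF c D (V.erase j)) * E j) := by
        rw [← mul_assoc, ← mul_assoc, h.DC y hyW z hzW hzy.symm]
        simp only [add_mul, neg_mul, smul_mul_assoc, mul_assoc]
      have i4 : (∏ x ∈ V, hh c x y) = hh c j y * ∏ x ∈ V.erase j, hh c x y :=
        (Finset.mul_prod_erase V (fun x => hh c x y) hj).symm
      rw [i3, Finset.prod_insert hyj, i4, prod_ff' c j hc]
      have r : (∏ x ∈ V.erase j, hh c x y) • (C j * tF c D (insert y (V.erase j)) * E z)
          = C j * (D y * tF c D (V.erase j)) * E z := by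
        rw [i1, mul_smul_comm, smul_mul_assoc]
      have r2 : (∏ x ∈ V.erase j, hh c x y) • (C z * tF c D (insert y (V.erase j)) * E j)
          = C z * (D y * tF c D (V.erase j)) * E j := by
        rw [i1, mul_smul_comm, smul_mul_assoc]
      have r3 : C y * (D j * tF c D (V.erase j)) * E z
          = (∏ x ∈ V.erase j, hh c x j) • (C y * tF c D V * E z) := by
        rw [i2, mul_smul_comm, smul_mul_assoc]
      have s1 : gg c z y * gg c y j + gg c j z * ff c z y = gg c j z * ff c j y := by
        have := sub_ne_zero.mpr hzy
        have := sub_ne_zero.mpr hjy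
        have := sub_ne_zero.mpr hjy.symm
        have := sub_ne_zero.mpr hjz
        unfold gg ff
        field_simp
        ring
      have s2 : ff c j y = - (hh c j y * gg c y j) := by
        rw [ff_eq c j y hc, gg_symm c j y]; ring
      have s3 : gg c z j = - gg c j z := gg_symm c z j
      have s4 : gg c z y * gg c y j + gg c j z * ff c z y = - gg c j z * (hh c j y * gg c y j) := by
        rw [s1, s2]; ring
      simp only [mul_smul_comm, mul_sub, d1, d2, r3]
      simp only [mul_assoc (C z), mul_assoc (C y), mul_assoc (C j), mul_assoc (D y),
        mul_assoc (D z)] at r r2 ⊢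
      rw [s2, s3]
      generalize C j * (D y * (tF c D (V.erase j) * E z)) = a1 at *
      generalize C z * (D y * (tF c D (V.erase j) * E j)) = a2 at *
      generalize C y * (D z * (tF c D (V.erase j) * E j)) = a3 at *
      generalize C y * (tF c D V * E z) = a4 at *
      generalize (∏ x ∈ V.erase j, gg c x j) = p at *
      generalize (∏ x ∈ V.erase j, hh c x j) = q at *
      linear_combination (norm := module) (p * s4) • a2
        - (hh c j y * (gg c j z * (gg c y j * p))) • r
        + (hh c j y * (gg c j z * (gg c y j * p))) • r2
    rw [l1, m1, m2, ih]
    simp only [mul_add, smul_add, Finset.mul_sum, Finset.smul_sum]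
    have pf := pfa c hc V y z hzy.symm hy hzV'
    rw [Finset.sum_insert hy, Finset.erase_insert hy]
    have comb := Finset.sum_congr rfl l2
    rw [Finset.sum_add_distrib, Finset.sum_sub_distrib, Finset.sum_add_distrib,
      ← Finset.sum_smul, ← pf] at comb
    have e1 : ∏ x ∈ V, ff c x y = (∏ x ∈ V, hh c x y) * ∏ x ∈ V, gg c x y := prod_ff' c y hc V
    have s3 : gg c z y = - gg c y z := gg_symm c z y
    simp only [mul_smul_comm, ← mul_assoc] at comb ⊢
    rw [e1] at comb ⊢
    rw [s3] at comb ⊢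
    linear_combination (norm := module) comb

end Base

section Main
variable {c : ℂ} {B C D E : ℂ → A} {W : Finset ℂ}

lemma sum_swap {M : Type*} [AddCommMonoid M] (V : Finset ℂ) (F : ℂ → ℂ → M) :
    ∑ j ∈ V, ∑ k ∈ V.erase j, F j k = ∑ j ∈ V, ∑ k ∈ V.erase j, F k j := by
  rw [Finset.sum_sigma', Finset.sum_sigma']
  refine Finset.sum_bij' (fun p _ => ⟨p.2, p.1⟩) (fun p _ => ⟨p.2, p.1⟩) ?_ ?_ ?_ ?_ ?_
  · rintro ⟨j, k⟩ h
    simp only [Finset.mem_sigma, Finset.mem_erase] at h ⊢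
    exact ⟨h.2.2, h.2.1.symm, h.1⟩
  · rintro ⟨j, k⟩ h
    simp only [Finset.mem_sigma, Finset.mem_erase] at h ⊢
    exact ⟨h.2.2, h.2.1.symm, h.1⟩
  · rintro ⟨j, k⟩ _; rfl
  · rintro ⟨j, k⟩ _; rfl
  · rintro ⟨j, k⟩ _; rfl

lemma final_scalar {j k z w : ℂ} (hjk : j ≠ k) (hjz : j ≠ z) (hjw : j ≠ w)
    (hkz : k ≠ z) (hkw : k ≠ w) :
    gg c j w * gg c z j * gg c k j * gg c k j - gg c k w * gg c z k * gg c j k * gg c j k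
      + gg c j z * ff c j w * gg c k j * gg c k w
      - gg c k w * (gg c k z * hh c z k) * gg c j z * gg c j k = 0 := by
  have := sub_ne_zero.mpr hjk
  have := sub_ne_zero.mpr hjk.symm
  have := sub_ne_zero.mpr hjz
  have := sub_ne_zero.mpr hjz.symm
  have := sub_ne_zero.mpr hjw
  have := sub_ne_zero.mpr hkz
  have := sub_ne_zero.mpr hkz.symm
  have := sub_ne_zero.mpr hkw
  unfold gg ff hh
  field_simp
  ring

lemma step_aux (hc : c ≠ 0) (h : Rel c B C D E W) {U V : Finset ℂ} {z w : ℂ}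
    (hzW : z ∈ W) (hwW : w ∈ W) (hzw : z ≠ w) (hzU : z ∉ U) (hwU : w ∉ U)
    (hzV : z ∉ V) (hwV : w ∉ V) (hV : V ⊆ W) (bv : Finset ℂ → A)
    (com : ∀ j ∈ V, B j * bv (V.erase j) - bv (V.erase j) * B j
      = ∑ k ∈ V.erase j, cf c j U (V.erase j) k •
        (C k * bv ((V.erase j).erase k) * E j - C j * bv ((V.erase j).erase k) * E k)) :
    B z * (bv V * B w + ∑ j ∈ V, cf c w U V j • (C j * bv (V.erase j) * E w))
      + ∑ j ∈ V, cf c z (insert w U) V j • (C z * (bv (V.erase j) * B w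
        + ∑ k ∈ V.erase j, cf c w U (V.erase j) k • (C k * bv ((V.erase j).erase k) * E w)) * E j)
    = (B z * bv V + ∑ j ∈ V, cf c z U V j • (C z * bv (V.erase j) * E j)) * B w
      + ∑ j ∈ V, cf c w (insert z U) V j • (C j * (B z * bv (V.erase j)
        + ∑ k ∈ V.erase j, cf c z U (V.erase j) k •
          (C z * bv ((V.erase j).erase k) * E k)) * E w) := by
  -- the difference of the two sides, term by term in `j`
  have t1 : ∀ j ∈ V,
      cf c w U V j • (B z * (C j * bv (V.erase j) * E w))
        + cf c z (insert w U) V j • (C z * (bv (V.erase j) * B w) * E j)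
      = cf c z U V j • (C z * bv (V.erase j) * E j * B w)
        + cf c w (insert z U) V j • (C j * (B z * bv (V.erase j)) * E w)
        + (gg c z j * cf c w U V j) •
          (C z * (B j * bv (V.erase j) - bv (V.erase j) * B j) * E w) := by
    intro j hj
    have hjW := hV hj
    have hjz : j ≠ z := fun e => hzV (e ▸ hj)
    have hjw : j ≠ w := fun e => hwV (e ▸ hj)
    have e1 : B z * (C j * bv (V.erase j) * E w)
        = ff c j z • (C j * (B z * bv (V.erase j)) * E w)
          + gg c z j • (C z * (B j * bv (V.erase j)) * E w) := by
      rw [← mul_assoc, ← mul_assoc, h.BC z hzW j hjW hjz.symm]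
      simp only [add_mul, smul_mul_assoc, mul_assoc]
    have e2 : C z * bv (V.erase j) * E j * B w
        = ff c j w • (C z * (bv (V.erase j) * B w) * E j)
          + gg c w j • (C z * (bv (V.erase j) * B j) * E w) := by
      rw [mul_assoc, h.EB j hjW w hwW hjw]
      simp only [mul_add, mul_smul_comm, mul_assoc]
    have e3 : cf c z (insert w U) V j = ff c j w * cf c z U V j := by
      unfold cf; rw [Finset.prod_insert hwU]; ring
    have e4 : cf c w (insert z U) V j = ff c j z * cf c w U V j := by
      unfold cf; rw [Finset.prod_insert hzU]; ring
    have e5 : cf c z U V j * gg c w j = gg c z j * cf c w U V j := by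
      unfold cf; rw [gg_symm c w j, gg_symm c z j]; ring
    rw [e1, e2, e3, e4, mul_sub, sub_mul]
    linear_combination (norm := module) (-e5) • (C z * (bv (V.erase j) * B j) * E w)
  have t2 : ∑ j ∈ V, (gg c z j * cf c w U V j) •
          (C z * (B j * bv (V.erase j) - bv (V.erase j) * B j) * E w)
        + ∑ j ∈ V, cf c z (insert w U) V j • (C z * (∑ k ∈ V.erase j, cf c w U (V.erase j) k •
          (C k * bv ((V.erase j).erase k) * E w)) * E j)
      = ∑ j ∈ V, cf c w (insert z U) V j • (C j * (∑ k ∈ V.erase j, cf c z U (V.erase j) k •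
          (C z * bv ((V.erase j).erase k) * E k)) * E w) := by
    have a1 : ∑ j ∈ V, (gg c z j * cf c w U V j) •
          (C z * (B j * bv (V.erase j) - bv (V.erase j) * B j) * E w)
        = ∑ j ∈ V, ∑ k ∈ V.erase j, (gg c z j * cf c w U V j * cf c j U (V.erase j) k) •
            (C z * C k * bv ((V.erase j).erase k) * (E j * E w))
          - ∑ j ∈ V, ∑ k ∈ V.erase j, (gg c z j * cf c w U V j * cf c j U (V.erase j) k) •
            (C z * C j * bv ((V.erase j).erase k) * (E k * E w)) := by
      rw [← Finset.sum_sub_distrib]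
      refine Finset.sum_congr rfl fun j hj => ?_
      rw [com j hj, ← Finset.sum_sub_distrib]
      simp only [Finset.mul_sum, Finset.sum_mul, Finset.smul_sum]
      refine Finset.sum_congr rfl fun k hk => ?_
      simp only [mul_smul_comm, smul_mul_assoc, smul_smul, mul_sub, sub_mul, smul_sub, mul_assoc]
    have a2 : ∑ j ∈ V, cf c z (insert w U) V j • (C z * (∑ k ∈ V.erase j, cf c w U (V.erase j) k •
          (C k * bv ((V.erase j).erase k) * E w)) * E j)
        = ∑ j ∈ V, ∑ k ∈ V.erase j, (cf c z (insert w U) V j * cf c w U (V.erase j) k) •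
            (C z * C k * bv ((V.erase j).erase k) * (E j * E w)) := by
      refine Finset.sum_congr rfl fun j hj => ?_
      simp only [Finset.mul_sum, Finset.sum_mul, Finset.smul_sum]
      refine Finset.sum_congr rfl fun k hk => ?_
      rw [h.EE j (hV hj) w hwW]
      simp only [mul_smul_comm, smul_mul_assoc, smul_smul, mul_assoc]
    have a3 : ∑ j ∈ V, cf c w (insert z U) V j • (C j * (∑ k ∈ V.erase j, cf c z U (V.erase j) k •
          (C z * bv ((V.erase j).erase k) * E k)) * E w)
        = ∑ j ∈ V, ∑ k ∈ V.erase j, (cf c w (insert z U) V j * cf c z U (V.erase j) k) •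
            (C j * C z * bv ((V.erase j).erase k) * (E k * E w)) := by
      refine Finset.sum_congr rfl fun j hj => ?_
      simp only [Finset.mul_sum, Finset.sum_mul, Finset.smul_sum]
      refine Finset.sum_congr rfl fun k hk => ?_
      simp only [mul_smul_comm, smul_mul_assoc, smul_smul, mul_assoc]
    rw [a1, a2, a3, sum_swap V (fun j k => (gg c z j * cf c w U V j * cf c j U (V.erase j) k) •
            (C z * C j * bv ((V.erase j).erase k) * (E k * E w))),
      sum_swap V (fun j k => (cf c w (insert z U) V j * cf c z U (V.erase j) k) •
            (C j * C z * bv ((V.erase j).erase k) * (E k * E w)))]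
    rw [← Finset.sum_sub_distrib, ← Finset.sum_add_distrib]
    refine Finset.sum_congr rfl fun j hj => ?_
    rw [← Finset.sum_sub_distrib, ← Finset.sum_add_distrib]
    refine Finset.sum_congr rfl fun k hk => ?_
    have hkV : k ∈ V := Finset.mem_of_mem_erase hk
    have hjk : j ≠ k := (Finset.ne_of_mem_erase hk).symm
    have hjk' : j ∈ V.erase k := Finset.mem_erase.mpr ⟨hjk, hj⟩
    have hjz : j ≠ z := fun e => hzV (e ▸ hj)
    have hjw : j ≠ w := fun e => hwV (e ▸ hj)
    have hkz : k ≠ z := fun e => hzV (e ▸ hkV)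
    have hkw : k ≠ w := fun e => hwV (e ▸ hkV)
    have hs : (V.erase k).erase j = (V.erase j).erase k := Finset.erase_right_comm
    have g1 : ∏ x ∈ V.erase j, gg c x j = gg c k j * ∏ x ∈ (V.erase j).erase k, gg c x j :=
      (Finset.mul_prod_erase _ (fun x => gg c x j) hk).symm
    have g2 : ∏ x ∈ V.erase k, gg c x k = gg c j k * ∏ x ∈ (V.erase j).erase k, gg c x k := by
      rw [← hs]; exact (Finset.mul_prod_erase _ (fun x => gg c x k) hjk').symm
    have q := h.CC k (hV hkV) z hzW
    have q' : ff c k z • (C k * C z * bv ((V.erase j).erase k) * (E j * E w))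
        = (gg c k z * hh c z k) • (C z * C k * bv ((V.erase j).erase k) * (E j * E w)) := by
      have q2 := congrArg (fun t => t * bv ((V.erase j).erase k) * (E j * E w)) q
      simp only [smul_mul_assoc] at q2
      rw [ff_eq c k z hc, mul_comm (hh c k z), mul_smul, mul_smul, q2]
    have s := final_scalar (c := c) hjk hjz hjw hkz hkw
    unfold cf
    rw [hs, Finset.prod_insert hwU, Finset.prod_insert hzU, g1, g2]
    generalize C k * C z * bv ((V.erase j).erase k) * (E j * E w) = o1 at *
    generalize C z * C k * bv ((V.erase j).erase k) * (E j * E w) = o2 at *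
    generalize ∏ x ∈ (V.erase j).erase k, gg c x j = p1
    generalize ∏ x ∈ (V.erase j).erase k, gg c x k = p2
    generalize ∏ x ∈ U, ff c j x = p3
    generalize ∏ x ∈ U, ff c k x = p4
    linear_combination (norm := module) (p1 * p2 * p3 * p4 * s) • o2 -
      (gg c k w * gg c j k * p2 * p4 * (gg c j z * p1 * p3)) • q'
  have t3 := Finset.sum_congr rfl t1
  simp only [Finset.sum_add_distrib] at t3
  simp only [mul_add, add_mul, smul_add, Finset.sum_add_distrib]
  have f1 : B z * ∑ j ∈ V, cf c w U V j • (C j * bv (V.erase j) * E w)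
      = ∑ j ∈ V, cf c w U V j • (B z * (C j * bv (V.erase j) * E w)) := by
    simp only [Finset.mul_sum, mul_smul_comm]
  have f2 : (∑ j ∈ V, cf c z U V j • (C z * bv (V.erase j) * E j)) * B w
      = ∑ j ∈ V, cf c z U V j • (C z * bv (V.erase j) * E j * B w) := by
    simp only [Finset.sum_mul, smul_mul_assoc]
  rw [f1, f2, ← mul_assoc (B z)]
  linear_combination (norm := module) t3 + t2

lemma XF_eq_YF (hc : c ≠ 0) (h : Rel c B C D E W) (n : ℕ) :
    ∀ U V : Finset ℂ, U.card = n → U ⊆ W → V ⊆ W → Disjoint V U →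
      XF c B C D E U V = YF c B C D E U V := by
  induction n using Nat.strong_induction_on with
  | _ n ih =>
  intro U V hn hU hV hd
  rcases U.eq_empty_or_nonempty with rfl | ⟨z, hz⟩
  · rw [XF_empty, YF_empty]
  obtain ⟨U1, hzU1, rfl⟩ : ∃ U1, z ∉ U1 ∧ U = insert z U1 :=
    ⟨U.erase z, Finset.notMem_erase _ _, (Finset.insert_erase hz).symm⟩
  have hzW : z ∈ W := hU hz
  rw [Finset.disjoint_insert_right] at hd
  rw [Finset.card_insert_of_notMem hzU1] at hn
  rcases U1.eq_empty_or_nonempty with rfl | ⟨w, hw⟩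
  · rw [XF_L hc h hU hV hzU1 hd.1 hd.2, YF_R hc h hU hV hzU1 hd.1 hd.2]
    simp only [XF_empty, YF_empty]
    have k := comm_one hc h hzW V hV hd.1
    simp only [smul_sub, Finset.sum_sub_distrib] at k
    simp only [cf, Finset.prod_empty, mul_one]
    linear_combination (norm := module) k
  obtain ⟨U0, hwU0, rfl⟩ : ∃ U0, w ∉ U0 ∧ U1 = insert w U0 :=
    ⟨U1.erase w, Finset.notMem_erase _ _, (Finset.insert_erase hw).symm⟩
  rw [Finset.disjoint_insert_right] at hd
  obtain ⟨hzV, hwV, hd⟩ := hd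
  rw [Finset.card_insert_of_notMem hwU0] at hn
  have hwW : w ∈ W := hU (by simp)
  have hU0 : U0 ⊆ W := fun x hx => hU (by simp [hx])
  have hzw : z ≠ w := fun e => hzU1 (by simp [e])
  have hzU0 : z ∉ U0 := fun e => hzU1 (by simp [e])
  have hzwU0 : z ∉ insert w U0 := hzU1
  have hwzU0 : w ∉ insert z U0 := by simp [hzw.symm, hwU0]
  have ih0 : ∀ V' ⊆ V, YF c B C D E U0 V' = XF c B C D E U0 V' := fun V' hV' =>
    (ih U0.card (by omega) U0 V' rfl hU0 (hV'.trans hV) (hd.mono_left hV')).symm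
  have ins : ∀ x ∈ W, insert x U0 ⊆ W := fun x hx => Finset.insert_subset hx hU0
  have ih1 : ∀ x ∈ W, x ∉ U0 → ∀ V' ⊆ V, x ∉ V' →
      XF c B C D E (insert x U0) V' = YF c B C D E (insert x U0) V' := by
    intro x hx hxU V' hV' hxV'
    refine ih (U0.card + 1) (by omega) _ V' (Finset.card_insert_of_notMem hxU) (ins x hx)
      (hV'.trans hV) ?_
    rw [Finset.disjoint_insert_right]
    exact ⟨hxV', hd.mono_left hV'⟩
  -- expansions on the intermediate level
  have eL : ∀ x ∈ W, x ∉ U0 → ∀ V' ⊆ V, x ∉ V' → XF c B C D E (insert x U0) V'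
      = B x * XF c B C D E U0 V' + ∑ j ∈ V', cf c x U0 V' j •
        (C x * XF c B C D E U0 (V'.erase j) * E j) := fun x hx hxU V' hV' hxV' =>
    XF_L hc h (ins x hx) (hV'.trans hV) hxU hxV' (hd.mono_left hV')
  have eR : ∀ x ∈ W, x ∉ U0 → ∀ V' ⊆ V, x ∉ V' → YF c B C D E (insert x U0) V'
      = XF c B C D E U0 V' * B x + ∑ j ∈ V', cf c x U0 V' j •
        (C j * XF c B C D E U0 (V'.erase j) * E x) := by
    intro x hx hxU V' hV' hxV'
    rw [YF_R hc h (ins x hx) (hV'.trans hV) hxU hxV' (hd.mono_left hV'), ih0 V' hV']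
    congr 1
    refine Finset.sum_congr rfl fun j _ => ?_
    rw [ih0 _ ((Finset.erase_subset _ _).trans hV')]
  have com : ∀ j ∈ V, B j * XF c B C D E U0 (V.erase j) - XF c B C D E U0 (V.erase j) * B j
      = ∑ k ∈ V.erase j, cf c j U0 (V.erase j) k •
        (C k * XF c B C D E U0 ((V.erase j).erase k) * E j
          - C j * XF c B C D E U0 ((V.erase j).erase k) * E k) := by
    intro j hj
    have hjU : j ∉ U0 := Finset.disjoint_left.mp hd hj
    have k1 := eL j (hV hj) hjU (V.erase j) (Finset.erase_subset _ _) (Finset.notMem_erase _ _)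
    have k2 := eR j (hV hj) hjU (V.erase j) (Finset.erase_subset _ _) (Finset.notMem_erase _ _)
    rw [ih1 j (hV hj) hjU (V.erase j) (Finset.erase_subset _ _) (Finset.notMem_erase _ _), k2] at k1
    simp only [smul_sub, Finset.sum_sub_distrib]
    linear_combination (norm := module) -k1
  have key := step_aux hc h hzW hwW hzw hzU0 hwU0 hzV hwV hV (XF c B C D E U0) com
  have hVj : ∀ j : ℂ, V.erase j ⊆ V := fun j => Finset.erase_subset _ _
  have x1 : XF c B C D E (insert z (insert w U0)) V = _ :=
    XF_L hc h hU hV hzwU0 hzV (by rw [Finset.disjoint_insert_right]; exact ⟨hwV, hd⟩)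
  have y1 : YF c B C D E (insert w (insert z U0)) V = _ :=
    YF_R hc h (by rw [Finset.insert_comm]; exact hU) hV hwzU0 hwV
      (by rw [Finset.disjoint_insert_right]; exact ⟨hzV, hd⟩)
  rw [x1, Finset.insert_comm, y1]
  rw [ih1 w hwW hwU0 V subset_rfl hwV, eR w hwW hwU0 V subset_rfl hwV,
    ← ih1 z hzW hzU0 V subset_rfl hzV, eL z hzW hzU0 V subset_rfl hzV]
  have x2 : ∀ j ∈ V, cf c z (insert w U0) V j •
        (C z * XF c B C D E (insert w U0) (V.erase j) * E j)
      = cf c z (insert w U0) V j • (C z * (XF c B C D E U0 (V.erase j) * B w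
        + ∑ k ∈ V.erase j, cf c w U0 (V.erase j) k •
          (C k * XF c B C D E U0 ((V.erase j).erase k) * E w)) * E j) := by
    intro j _
    have : w ∉ V.erase j := fun e => hwV (Finset.mem_of_mem_erase e)
    rw [ih1 w hwW hwU0 _ (hVj j) this, eR w hwW hwU0 _ (hVj j) this]
  have y2 : ∀ j ∈ V, cf c w (insert z U0) V j •
        (C j * YF c B C D E (insert z U0) (V.erase j) * E w)
      = cf c w (insert z U0) V j • (C j * (B z * XF c B C D E U0 (V.erase j)
        + ∑ k ∈ V.erase j, cf c z U0 (V.erase j) k •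
          (C z * XF c B C D E U0 ((V.erase j).erase k) * E k)) * E w) := by
    intro j _
    have : z ∉ V.erase j := fun e => hzV (Finset.mem_of_mem_erase e)
    rw [← ih1 z hzW hzU0 _ (hVj j) this, eL z hzW hzU0 _ (hVj j) this]
  rw [Finset.sum_congr rfl x2, Finset.sum_congr rfl y2]
  exact key

end Main

section Final

lemma gg_anti (c x y : ℂ) : gg c y x = -gg c x y := by
  unfold gg
  rw [← neg_sub x y, div_neg]

lemma hh_mul_gg (c x y : ℂ) (hc : c ≠ 0) (h : x ≠ y) : gg c x y * hh c x y = 1 + gg c x y := by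
  have : x - y ≠ 0 := sub_ne_zero.2 h
  unfold gg hh
  field_simp

lemma gg_ne (c x y : ℂ) (hc : c ≠ 0) (h : x ≠ y) : gg c x y ≠ 0 :=
  div_ne_zero hc (sub_ne_zero.2 h)

lemma comm_aux (c : ℂ) (hc : c ≠ 0) (W : Finset ℂ) (hG : Good c W) (Q : ℂ → A)
    (h : ∀ x y, x ≠ y → Q x * Q y - Q y * Q x = gg c x y • (Q x * Q y - Q y * Q x)) :
    QCom Q W := by
  intro x hx y hy
  by_cases hxy : x = y
  · rw [hxy]
  have h1 := h x y hxy
  have h2 := hh_mul_gg c y x hc (Ne.symm hxy)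
  have h3 : (gg c y x * hh c y x) ≠ 0 := mul_ne_zero (gg_ne c y x hc (Ne.symm hxy)) (hG y hy x hx)
  rw [h2, gg_anti] at h3
  apply smul_cancel h3
  linear_combination (norm := module) h1

lemma anti_aux (c : ℂ) (hc : c ≠ 0) (W : Finset ℂ) (Q : ℂ → A)
    (h : ∀ x y, x ≠ y → Q x * Q y + Q y * Q x = -gg c x y • (Q x * Q y - Q y * Q x)) :
    QSym c Q W := by
  intro x hx y hy
  by_cases hxy : x = y
  · rw [hxy]
  have h1 := h x y hxy
  have h2 := hh_mul_gg c y x hc (Ne.symm hxy)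
  have h4 := hh_mul_gg c x y hc hxy
  apply smul_cancel (gg_ne c x y hc hxy)
  rw [smul_smul, smul_smul, h4]
  have h5 : gg c x y * hh c y x = -1 + gg c x y := by
    rw [gg_anti c x y] at h2
    linear_combination -h2
  rw [h5]
  linear_combination (norm := module) h1

lemma rel_of_fam (c : ℂ) (hc : c ≠ 0) (T : Fin 3 → Fin 3 → ℂ → A)
    (hT : IsTFam c p21 T) (W : Finset ℂ) (hG : Good c W) :
    Rel c (T 0 1) (T 0 2) (T 1 2) (T 1 1) W where
  good := hG
  BB := by
    apply comm_aux c hc W hG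
    intro x y hxy
    have := hT 0 1 0 1 x y hxy
    simp [p21] at this
    linear_combination (norm := module) this
  EE := by
    apply comm_aux c hc W hG
    intro x y hxy
    have := hT 1 1 1 1 x y hxy
    simp [p21] at this
    linear_combination (norm := module) this
  CC := by
    apply anti_aux c hc W
    intro x y hxy
    have := hT 0 2 0 2 x y hxy
    simp [p21] at this
    linear_combination (norm := module) this
  DD := by
    apply anti_aux c hc W
    intro x y hxy
    have := hT 1 2 1 2 x y hxy
    simp [p21] at this
    linear_combination (norm := module) this
  BC := by
    intro x hx y hy hxy
    have := hT 0 1 0 2 x y hxy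
    simp [p21] at this
    rw [ff_eq' c y x (Ne.symm hxy), gg_anti c x y]
    linear_combination (norm := module) this
  EB := by
    intro x hx y hy hxy
    have := hT 0 1 1 1 y x (Ne.symm hxy)
    simp [p21] at this
    rw [ff_eq' c x y hxy, gg_anti c x y]
    rw [gg_anti c x y] at this
    linear_combination (norm := module) (-1:ℂ) • this
  ED := by
    intro x hx y hy hxy
    have := hT 1 1 1 2 x y hxy
    simp [p21] at this
    rw [ff_eq' c y x (Ne.symm hxy), gg_anti c x y]
    linear_combination (norm := module) this
  DC := by
    intro x hx y hy hxy
    have := hT 0 2 1 2 y x (Ne.symm hxy)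
    simp [p21] at this
    rw [ff_eq' c y x (Ne.symm hxy)]
    linear_combination (norm := module) this
  BD := by
    intro x hx y hy hxy
    have := hT 0 1 1 2 x y hxy
    simpa [p21] using this

/-- the image of a set of positions -/
def im (l : List ℂ) (S : Finset (Fin l.length)) : Finset ℂ := S.image l.get

lemma sel_nodup {l : List ℂ} (hl : l.Nodup) (S : Finset (Fin l.length)) : (sel l S).Nodup := by
  unfold sel
  exact (Finset.sort_nodup _ _).map (List.nodup_iff_injective_get.1 hl)

lemma sel_toFinset (l : List ℂ) (S : Finset (Fin l.length)) : (sel l S).toFinset = im l S := by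
  ext x
  simp [sel, im]

lemma sel_length (l : List ℂ) (S : Finset (Fin l.length)) : (sel l S).length = S.card := by
  simp [sel]

lemma im_card {l : List ℂ} (hl : l.Nodup) (S : Finset (Fin l.length)) : (im l S).card = S.card :=
  Finset.card_image_of_injective _ (List.nodup_iff_injective_get.1 hl)

lemma im_univ (l : List ℂ) : im l Finset.univ = l.toFinset := by
  ext x
  simp only [im, Finset.mem_image, Finset.mem_univ, true_and, List.mem_toFinset]
  exact List.mem_iff_get.symm

lemma im_compl {l : List ℂ} (hl : l.Nodup) (S : Finset (Fin l.length)) :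
    im l Sᶜ = l.toFinset \ im l S := by
  rw [← im_univ, im, im, im, ← Finset.image_sdiff_of_injOn, Finset.compl_eq_univ_sdiff]
  · exact (List.nodup_iff_injective_get.1 hl).injOn
  · exact Finset.subset_univ _

lemma sel_perm {l : List ℂ} (hl : l.Nodup) (S : Finset (Fin l.length)) :
    (sel l S).Perm (im l S).toList := by
  rw [← sel_toFinset]
  exact (List.toFinset_toList (sel_nodup hl S)).symm

lemma sel_sub {l : List ℂ} (S : Finset (Fin l.length)) {x : ℂ} (hx : x ∈ sel l S) :
    x ∈ l.toFinset := by
  have h : x ∈ im l S := by rw [← sel_toFinset]; simpa using hx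
  rw [← im_univ]
  exact Finset.image_subset_image (Finset.subset_univ S) h

lemma sum_sel {M : Type*} [AddCommMonoid M] {l : List ℂ} (hl : l.Nodup) (F : Finset ℂ → M) :
    ∑ S : Finset (Fin l.length), F (im l S) = ∑ S ∈ l.toFinset.powerset, F S := by
  refine Finset.sum_bij (fun S _ => im l S) ?_ ?_ ?_ ?_
  · intro S _
    rw [Finset.mem_powerset, ← im_univ]
    exact Finset.image_subset_image (Finset.subset_univ S)
  · intro S _ S' _ h
    exact Finset.image_injective (List.nodup_iff_injective_get.1 hl) h
  · intro S hS
    rw [Finset.mem_powerset, ← im_univ] at hS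
    obtain ⟨S', _, h⟩ := Finset.subset_image_iff.1 hS
    exact ⟨S', Finset.mem_univ _, h⟩
  · intros; rfl

lemma list_DP (φ : ℂ → ℂ → ℂ) {l₁ l₂ : List ℂ} (h₁ : l₁.Nodup) (h₂ : l₂.Nodup) :
    (l₁.map fun x => (l₂.map fun y => φ x y).prod).prod = DP φ l₁.toFinset l₂.toFinset := by
  unfold DP
  rw [List.prod_toFinset _ h₁]
  congr 1
  apply List.map_congr_left
  intro x _
  rw [List.prod_toFinset _ h₂]

lemma prodHHne_DP (c : ℂ) (hc : c ≠ 0) {l : List ℂ} (h : l.Nodup) :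
    prodHHne c l = DP (hh c) l.toFinset l.toFinset := by
  rw [← list_DP _ h h]
  unfold prodHHne
  have key : ∀ F : ℂ → ℂ, (l.map F).prod = ∏ j : Fin l.length, F (l.get j) := by
    intro F
    rw [← List.prod_ofFn]
    congr 1
    apply List.ext_get <;> simp
  rw [key]
  refine Finset.prod_congr rfl fun j _ => ?_
  rw [key]
  refine Finset.prod_congr rfl fun k _ => ?_
  by_cases hjk : j = k
  · subst hjk
    simp [hh_self c _ hc]
  · simp [hjk]

lemma lamP_smul {M : Type*} [AddCommGroup M] [Module ℂ M] [Module A M] [IsScalarTower ℂ A M]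
    (E : ℂ → A) (lam2 : ℂ → ℂ) (Ω : M) (h : ∀ z, E z • Ω = lam2 z • Ω) (l : List ℂ) :
    Tprod E l • Ω = lamP lam2 l • Ω := by
  induction l with
  | nil => simp [Tprod, lamP]
  | cons x l ih =>
    rw [Tprod_cons, mul_smul, ih]
    have : E x • (lamP lam2 l • Ω) = lamP lam2 l • (E x • Ω) := by
      rw [← smul_one_smul A (lamP lam2 l) Ω, ← smul_assoc (lamP lam2 l) (E x) Ω, ← mul_smul]
      simp
    rw [this, h, smul_smul]
    simp [lamP, mul_comm]

lemma op_lam {M : Type*} [AddCommGroup M] [Module ℂ M] [Module A M] [IsScalarTower ℂ A M]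
    (a e : A) (k m : ℂ) (Ω : M) (h : e • Ω = m • Ω) :
    ((k * m) • a) • Ω = (k • (a * e)) • Ω := by
  rw [smul_assoc k (a * e) Ω, mul_smul a e Ω, h, ← smul_one_smul A m Ω, ← mul_smul a,
    ← smul_assoc]
  congr 1
  simp [mul_smul]

lemma good_of_adm (c : ℂ) (hc : c ≠ 0) (l : List ℂ) (h : Admissible c l) :
    Good c l.toFinset ∧ l.Nodup := by
  refine ⟨?_, ?_⟩
  · intro x hx y hy
    by_cases hxy : x = y
    · rw [hxy, hh_self c y hc]; exact one_ne_zero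
    have hs : ∀ x ∈ l, ∀ y ∈ l, x ≠ y → (x - y + c ≠ 0) := by
      have h' : l.Pairwise fun x y => x ≠ y → (x - y + c ≠ 0 ∧ y - x + c ≠ 0) :=
        h.imp fun h _ => h.2
      haveI : Std.Symm (fun x y : ℂ => x ≠ y → (x - y + c ≠ 0 ∧ y - x + c ≠ 0)) :=
        ⟨fun x y h1 h2 => And.symm (h1 (Ne.symm h2))⟩
      have := List.Pairwise.forall_of_forall (fun x _ h1 => absurd rfl h1) h'
      intro x hx y hy hxy
      exact (this hx hy hxy).1
    exact div_ne_zero (hs x (by simpa using hx) y (by simpa using hy) hxy) hc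
  · exact List.Pairwise.imp (fun h => h.1) h

lemma phiA_term {M : Type*} [AddCommGroup M] [Module ℂ M] [Module A M] [IsScalarTower ℂ A M]
    (c : ℂ) (hc : c ≠ 0) (T : Fin 3 → Fin 3 → ℂ → A) (lam2 : ℂ → ℂ) (Ω : M)
    (hw : ∀ z, T 1 1 z • Ω = lam2 z • Ω) (W : Finset ℂ)
    (h : Rel c (T 0 1) (T 0 2) (T 1 2) (T 1 1) W) (u v : List ℂ) (hu : u.Nodup) (hv : v.Nodup)
    (huW : u.toFinset ⊆ W) (hvW : v.toFinset ⊆ W) :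
    PhiA c T lam2 u v • Ω = XF c (T 0 1) (T 0 2) (T 1 2) (T 1 1) u.toFinset v.toFinset • Ω := by
  unfold PhiA XF
  simp only [Finset.sum_smul]
  rw [← sum_sel hu]
  refine Finset.sum_congr rfl fun S _ => ?_
  rw [← sum_sel hv]
  refine Finset.sum_congr rfl fun Q _ => ?_
  unfold XC
  rw [im_card hu, im_card hv]
  by_cases hSQ : S.card = Q.card
  swap
  · simp [hSQ]
  rw [if_pos hSQ, if_pos hSQ]
  have hE : Tprod (T 1 1) (sel v Q) • Ω = lamP lam2 (sel v Q) • Ω := lamP_smul _ _ _ hw _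
  rw [op_lam _ _ _ _ _ hE]
  unfold prodGG prodFF
  rw [list_DP (gg c) (sel_nodup hv Q) (sel_nodup hu S),
    list_DP (ff c) (sel_nodup hu S) (sel_nodup hu Sᶜ),
    list_DP (gg c) (sel_nodup hv Qᶜ) (sel_nodup hv Q),
    prodHHne_DP c hc (sel_nodup hu S)]
  simp only [sel_toFinset, im_compl hu, im_compl hv]
  unfold tF pF
  rw [← im_compl hu, ← im_compl hv,
    TT_perm c _ W h.good h.CC (sel_perm hu S) (fun x hx => huW (sel_sub S hx)),
    TT_perm c _ W h.good h.DD (sel_perm hv Qᶜ) (fun x hx => hvW (sel_sub _ hx)),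
    Tprod_perm _ W h.BB (sel_perm hu Sᶜ) (fun x hx => huW (sel_sub _ hx)),
    Tprod_perm _ W h.EE (sel_perm hv Q) (fun x hx => hvW (sel_sub _ hx))]
  simp only [mul_assoc]

lemma phiB_term {M : Type*} [AddCommGroup M] [Module ℂ M] [Module A M] [IsScalarTower ℂ A M]
    (c : ℂ) (T : Fin 3 → Fin 3 → ℂ → A) (lam2 : ℂ → ℂ) (Ω : M)
    (hw : ∀ z, T 1 1 z • Ω = lam2 z • Ω) (W : Finset ℂ)
    (h : Rel c (T 0 1) (T 0 2) (T 1 2) (T 1 1) W) (u v : List ℂ) (hu : u.Nodup) (hv : v.Nodup)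
    (huW : u.toFinset ⊆ W) (hvW : v.toFinset ⊆ W) :
    PhiB c T lam2 u v • Ω = YF c (T 0 1) (T 0 2) (T 1 2) (T 1 1) u.toFinset v.toFinset • Ω := by
  unfold PhiB YF
  simp only [Finset.sum_smul]
  rw [← sum_sel hu]
  refine Finset.sum_congr rfl fun S _ => ?_
  rw [← sum_sel hv]
  refine Finset.sum_congr rfl fun Q _ => ?_
  unfold YC
  rw [im_card hu, im_card hv]
  by_cases hSQ : S.card = Q.card
  swap
  · simp [hSQ]
  rw [if_pos hSQ, if_pos hSQ]
  have hE : Tprod (T 1 1) (sel u S) • Ω = lamP lam2 (sel u S) • Ω := lamP_smul _ _ _ hw _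
  rw [op_lam _ _ _ _ _ hE]
  unfold prodGG prodFF
  rw [list_DP (ff c) (sel_nodup hu S) (sel_nodup hu Sᶜ),
    list_DP (gg c) (sel_nodup hv Qᶜ) (sel_nodup hv Q),
    KizL_toFinset c _ _ (sel_nodup hv Q) (sel_nodup hu S) (by rw [sel_length, sel_length, hSQ])]
  simp only [sel_toFinset, im_compl hu, im_compl hv]
  unfold tF pF
  rw [← im_compl hu, ← im_compl hv,
    TT_perm c _ W h.good h.CC (sel_perm hv Q) (fun x hx => hvW (sel_sub _ hx)),
    TT_perm c _ W h.good h.DD (sel_perm hv Qᶜ) (fun x hx => hvW (sel_sub _ hx)),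
    Tprod_perm _ W h.BB (sel_perm hu Sᶜ) (fun x hx => huW (sel_sub _ hx)),
    Tprod_perm _ W h.EE (sel_perm hu S) (fun x hx => huW (sel_sub _ hx))]
  simp only [mul_assoc]

end Final

/-- the two explicit expressions for the `Y(2|1)` Bethe vector agree. -/
theorem statement5 {M : Type*} [AddCommGroup M] [Module ℂ M] [Module A M]
    [IsScalarTower ℂ A M]
    (c : ℂ) (hc : c ≠ 0) (T : Fin 3 → Fin 3 → ℂ → A)
    (hT : IsTFam c p21 T) (lam : Fin 3 → ℂ → ℂ) (Ω : M)
    (hw0 : ∀ i j : Fin 3, j < i → ∀ z : ℂ, T i j z • Ω = 0)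
    (hw1 : ∀ i : Fin 3, ∀ z : ℂ, T i i z • Ω = lam i z • Ω)
    (u v : List ℂ) (hadm : Admissible c (u ++ v)) :
    PhiA c T (lam 1) u v • Ω = PhiB c T (lam 1) u v • Ω := by
  obtain ⟨hG, hnd⟩ := good_of_adm c hc _ hadm
  have hR := rel_of_fam c hc T hT _ hG
  obtain ⟨hu, hv, hd⟩ := List.nodup_append'.1 hnd
  have huW : u.toFinset ⊆ (u ++ v).toFinset := by
    intro x hx
    simp only [List.mem_toFinset, List.mem_append] at hx ⊢
    exact Or.inl hx
  have hvW : v.toFinset ⊆ (u ++ v).toFinset := by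
    intro x hx
    simp only [List.mem_toFinset, List.mem_append] at hx ⊢
    exact Or.inr hx
  have hdis : Disjoint v.toFinset u.toFinset := by
    rw [Finset.disjoint_left]
    intro x hx hx2
    exact hd (List.mem_toFinset.1 hx2) (List.mem_toFinset.1 hx)
  rw [phiA_term c hc T (lam 1) Ω (hw1 1) _ hR u v hu hv huW hvW,
    phiB_term c T (lam 1) Ω (hw1 1) _ hR u v hu hv huW hvW,
    XF_eq_YF hc hR _ u.toFinset v.toFinset rfl huW hvW hdis]
end Bethe
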